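/- For each M > 0 and each maximizer ω ∈ S_M, there exist constants W > 0 and γ ≥ 0 such that ω = 1_{{x ∈ ℝ²₊ : 𝒢[ω](x) − W·x₂ − γ > 0}} a.e. in ℝ²₊. Moreover these constants are uniquely determined by ω: if W' ∈ ℝ and γ' ∈ ℝ also satisfy ω = 1_{{x ∈ ℝ²₊ : 𝒢[ω](x) − W'·x₂ − γ' > 0}} a.e. in ℝ²₊, then W' = W and γ' = γ. -/

import Mathlib

open MeasureTheory Real Set NNReal Filter Topology

noncomputable section

/-- The upper half plane `ℝ²₊`. -/
def H : Set (ℝ × ℝ) := {p | 0 < p.2}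

/-- The half-plane Green function
`G(x,y) = (1/(4π)) log(1 + 4 x₂ y₂ / |x-y|²)` (Euclidean distance). -/
def G (x y : ℝ × ℝ) : ℝ :=
  (1 / (4 * π)) * Real.log (1 + 4 * x.2 * y.2 / ((x.1 - y.1) ^ 2 + (x.2 - y.2) ^ 2))

/-- The potential `𝒢[ω](x) = ∫_{ℝ²₊} G(x,y) ω(y) dy`. -/
def Gpot (ω : ℝ × ℝ → ℝ) (x : ℝ × ℝ) : ℝ := ∫ y in H, G x y * ω y

/-- The kinetic energy `E(ω) = (1/2) ∫∫ G(x,y) ω(x) ω(y) dy dx`. -/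
def energy (ω : ℝ × ℝ → ℝ) : ℝ :=
  (1 / 2) * ∫ x in H, ∫ y in H, G x y * ω x * ω y

/-- The `L¹(ℝ²₊)` norm (mass). -/
def norm1 (ω : ℝ × ℝ → ℝ) : ℝ := ∫ x in H, |ω x|

/-- The `L²(ℝ²₊)` norm. -/
def norm2 (ω : ℝ × ℝ → ℝ) : ℝ := (∫ x in H, ω x ^ 2) ^ ((1 : ℝ) / 2)

/-- The impulse `‖x₂ ω‖₁ = ∫_{ℝ²₊} x₂ |ω(x)| dx`. -/
def impulse (ω : ℝ × ℝ → ℝ) : ℝ := ∫ x in H, x.2 * |ω x|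

/-- `ω ∈ (L¹ ∩ L²)(ℝ²₊)`. -/
def MemL1L2 (ω : ℝ × ℝ → ℝ) : Prop :=
  Integrable ω (volume.restrict H) ∧ Integrable (fun x => ω x ^ 2) (volume.restrict H)

/-- Finiteness of the impulse `‖x₂ ω‖₁ < ∞`. -/
def ImpulseFinite (ω : ℝ × ℝ → ℝ) : Prop :=
  Integrable (fun x : ℝ × ℝ => x.2 * |ω x|) (volume.restrict H)

/-- The admissible class `K_M`: patches `ω = 1_A` a.e. on `ℝ²₊` with
impulse `∫_A x₂ = M` and mass `|A| ≤ 1`. -/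
def memK (M : ℝ) (ω : ℝ × ℝ → ℝ) : Prop :=
  Integrable ω (volume.restrict H) ∧
  ∃ A : Set (ℝ × ℝ), A ⊆ H ∧ MeasurableSet A ∧
    (∀ᵐ x ∂volume.restrict H, ω x = A.indicator (fun _ => (1 : ℝ)) x) ∧
    (∫ x in A, x.2) = M ∧ volume A ≤ 1

/-- The admissible class `K_{M,∞}`: patches `ω = 1_A` a.e. on `ℝ²₊` with
impulse `∫_A x₂ = M`, without any mass bound. -/
def memKinf (M : ℝ) (ω : ℝ × ℝ → ℝ) : Prop :=
  Integrable ω (volume.restrict H) ∧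
  ∃ A : Set (ℝ × ℝ), A ⊆ H ∧ MeasurableSet A ∧
    (∀ᵐ x ∂volume.restrict H, ω x = A.indicator (fun _ => (1 : ℝ)) x) ∧
    (∫ x in A, x.2) = M

/-- The relaxed admissible class `K̃_M`: measurable `0 ≤ ω ≤ 1` with
mass `≤ 1` and impulse `≤ M`. -/
def memKt (M : ℝ) (ω : ℝ × ℝ → ℝ) : Prop :=
  Integrable ω (volume.restrict H) ∧
  (∀ᵐ x ∂volume.restrict H, 0 ≤ ω x ∧ ω x ≤ 1) ∧
  norm1 ω ≤ 1 ∧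
  Integrable (fun x : ℝ × ℝ => x.2 * |ω x|) (volume.restrict H) ∧
  impulse ω ≤ M

/-- The set of maximizers `S_M` of the energy over `K_M`. -/
def memS (M : ℝ) (ω : ℝ × ℝ → ℝ) : Prop :=
  memK M ω ∧ ∀ ω' : ℝ × ℝ → ℝ, memK M ω' → energy ω' ≤ energy ω

/-- The maximal energy `I_M` over `K_M`. -/
def Isup (M : ℝ) : ℝ := sSup (energy '' {ω | memK M ω})

/-- The maximal energy `I_{1,∞}` over `K_{1,∞}`. -/
def IsupInf : ℝ := sSup (energy '' {ω | memKinf 1 ω})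

/-- The Steiner symmetry condition for a set `Ω ⊆ ℝ²₊`. -/
def SteinerSet (Ω : Set (ℝ × ℝ)) : Prop :=
  (∀ x₁ x₂ : ℝ, 0 < x₂ → (((x₁, x₂) : ℝ × ℝ) ∈ Ω ↔ ((-x₁, x₂) : ℝ × ℝ) ∈ Ω)) ∧
  (∀ x₂ : ℝ, 0 < x₂ → ∀ a b : ℝ, 0 ≤ a → a ≤ b →
    ((b, x₂) : ℝ × ℝ) ∈ Ω → ((a, x₂) : ℝ × ℝ) ∈ Ω)

/-- The Steiner symmetry condition for a nonnegative function on `ℝ²₊`. -/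
def SteinerFn (f : ℝ × ℝ → ℝ) : Prop :=
  (∀ x₁ x₂ : ℝ, 0 < x₂ → f (x₁, x₂) = f (-x₁, x₂)) ∧
  (∀ x₂ : ℝ, 0 < x₂ → ∀ a b : ℝ, 0 ≤ a → a ≤ b → f (b, x₂) ≤ f (a, x₂))

/-! ### Bounds on the Green function -/

lemma measurableSet_H : MeasurableSet H := measurableSet_lt measurable_const measurable_snd

lemma measurable_G : Measurable (fun p : (ℝ × ℝ) × (ℝ × ℝ) => G p.1 p.2) := by
  unfold G; fun_prop

lemma measurable_G_right (x : ℝ × ℝ) : Measurable (G x) := by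
  unfold G; fun_prop

lemma G_comm (x y : ℝ × ℝ) : G x y = G y x := by
  unfold G
  congr 3
  ring

lemma G_ratio_nonneg {x y : ℝ × ℝ} (hx : x ∈ H) (hy : y ∈ H) :
    0 ≤ 4 * x.2 * y.2 / ((x.1 - y.1) ^ 2 + (x.2 - y.2) ^ 2) := by
  have h1 : 0 < x.2 := hx
  have h2 : 0 < y.2 := hy
  positivity

lemma G_nonneg {x y : ℝ × ℝ} (hx : x ∈ H) (hy : y ∈ H) : 0 ≤ G x y := by
  unfold G
  have h := G_ratio_nonneg hx hy
  have := Real.log_nonneg (show 1 ≤ 1 + 4 * x.2 * y.2 / ((x.1 - y.1) ^ 2 + (x.2 - y.2) ^ 2) by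
    linarith)
  positivity

lemma sq_log_one_add_le {z : ℝ} (hz : 0 ≤ z) : Real.log (1 + z) ^ 2 ≤ 16 * √z := by
  set w := √√z with hw
  have hw0 : 0 ≤ w := Real.sqrt_nonneg _
  have hw2 : w ^ 2 = √z := Real.sq_sqrt (Real.sqrt_nonneg _)
  have hw4 : w ^ 4 = z := by
    rw [show w ^ 4 = (w ^ 2) ^ 2 by ring, hw2, Real.sq_sqrt hz]
  have h1 : Real.log (1 + z) ≤ 4 * w := by
    have h2 : Real.log (1 + z) ≤ Real.log ((1 + w) ^ 4) := by
      apply Real.log_le_log (by linarith)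
      rw [← hw4]
      nlinarith [pow_nonneg hw0 2, pow_nonneg hw0 3]
    rw [Real.log_pow] at h2
    have h3 := Real.log_le_sub_one_of_pos (show 0 < 1 + w by linarith)
    push_cast at h2
    linarith
  have h0 : 0 ≤ Real.log (1 + z) := Real.log_nonneg (by linarith)
  rw [← hw2]
  nlinarith

/-- The truncated inverse square root, an integrable singularity on the line. -/
def sing (t : ℝ) : ℝ := (Icc (-1 : ℝ) 1).indicator (fun t => (√|t|)⁻¹) t

lemma sing_nonneg (t : ℝ) : 0 ≤ sing t :=
  indicator_nonneg (fun _ _ => by positivity) _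

lemma integrable_sing : Integrable sing := by
  have h : IntegrableOn (fun t : ℝ => (√|t|)⁻¹) (Icc (-1 : ℝ) 1) := by
    have h0 : IntegrableOn (fun t : ℝ => (√|t|)⁻¹) (Icc (0 : ℝ) 1) := by
      have := (intervalIntegral.intervalIntegrable_rpow' (r := -(1 / 2 : ℝ)) (a := 0) (b := 1)
        (by norm_num))
      rw [intervalIntegrable_iff_integrableOn_Icc_of_le zero_le_one] at this
      refine this.congr_fun (fun t ht => ?_) measurableSet_Icc
      simp only
      rw [Real.rpow_neg ht.1, abs_of_nonneg ht.1, Real.sqrt_eq_rpow]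
    have h1 : IntegrableOn (fun t : ℝ => (√|t|)⁻¹) (Icc (-1 : ℝ) 0) := by
      have := h0.comp_neg
      simpa using this
    have := h1.union h0
    rwa [Icc_union_Icc_eq_Icc (by norm_num) (by norm_num)] at this
  exact (integrable_indicator_iff measurableSet_Icc).2 h

/-- A planar function dominating `1 / |w| - 1`. -/
def sing2 (w : ℝ × ℝ) : ℝ := sing w.1 * sing w.2

lemma sing2_nonneg (w : ℝ × ℝ) : 0 ≤ sing2 w := mul_nonneg (sing_nonneg _) (sing_nonneg _)

lemma integrable_sing2 : Integrable sing2 := integrable_sing.mul_prod integrable_sing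

lemma inv_sqrt_le_sing2 {a b : ℝ} (ha : a ≠ 0) (hb : b ≠ 0) :
    (√(a ^ 2 + b ^ 2))⁻¹ ≤ 1 + sing2 (a, b) := by
  by_cases h : |a| ≤ 1 ∧ |b| ≤ 1
  · have e : sing2 (a, b) = (√(|a| * |b|))⁻¹ := by
      have h1 : a ∈ Icc (-1 : ℝ) 1 := abs_le.1 h.1
      have h2 : b ∈ Icc (-1 : ℝ) 1 := abs_le.1 h.2
      unfold sing2 sing
      rw [indicator_of_mem h1, indicator_of_mem h2, Real.sqrt_mul (abs_nonneg a), mul_inv]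
    rw [e]
    have ha' := abs_pos.2 ha
    have hb' := abs_pos.2 hb
    have : (√(a ^ 2 + b ^ 2))⁻¹ ≤ (√(|a| * |b|))⁻¹ := by
      apply inv_anti₀ (by positivity)
      apply Real.sqrt_le_sqrt
      rw [← sq_abs a, ← sq_abs b]
      nlinarith [sq_nonneg (|a| - |b|)]
    linarith
  · have h1 : 1 ≤ a ^ 2 + b ^ 2 := by
      rw [← sq_abs a, ← sq_abs b]
      by_contra! h2
      exact h ⟨by nlinarith [sq_nonneg |b|, abs_nonneg a],
        by nlinarith [sq_nonneg |a|, abs_nonneg b]⟩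
    have : (√(a ^ 2 + b ^ 2))⁻¹ ≤ 1 := inv_le_one_of_one_le₀ (Real.one_le_sqrt.2 h1)
    linarith [sing2_nonneg (a, b)]

lemma sq_G_le {x y : ℝ × ℝ} (hx : x ∈ H) (hy : y ∈ H) (h1 : x.1 ≠ y.1) (h2 : x.2 ≠ y.2) :
    G x y ^ 2 ≤ 1 + 2 * x.2 * (1 + sing2 (x - y)) := by
  have hx2 : 0 < x.2 := hx
  have hy2 : 0 < y.2 := hy
  have hd1 := sub_ne_zero.2 h1
  have hd2 := sub_ne_zero.2 h2
  have key := inv_sqrt_le_sing2 hd1 hd2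
  have hz := G_ratio_nonneg hx hy
  have hlog := sq_log_one_add_le hz
  have hρ2 : 0 < (x.1 - y.1) ^ 2 + (x.2 - y.2) ^ 2 := by positivity
  set ρ := √((x.1 - y.1) ^ 2 + (x.2 - y.2) ^ 2) with hρ
  have hρ0 : 0 < ρ := Real.sqrt_pos.2 hρ2
  have hyρ : y.2 ≤ x.2 + ρ := by
    have : |x.2 - y.2| ≤ ρ := by
      rw [← Real.sqrt_sq_eq_abs]
      exact Real.sqrt_le_sqrt (by nlinarith [sq_nonneg (x.1 - y.1)])
    linarith [neg_abs_le (x.2 - y.2)]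
  have hs : √(4 * x.2 * y.2 / ((x.1 - y.1) ^ 2 + (x.2 - y.2) ^ 2)) ≤ 1 + 2 * x.2 * ρ⁻¹ := by
    rw [Real.sqrt_div' _ hρ2.le, ← hρ]
    have : √(4 * x.2 * y.2) ≤ x.2 + y.2 := by
      apply Real.sqrt_le_iff.2 ⟨by linarith, by nlinarith [sq_nonneg (x.2 - y.2)]⟩
    rw [div_le_iff₀ hρ0]
    have e : (1 + 2 * x.2 * ρ⁻¹) * ρ = ρ + 2 * x.2 := by field_simp
    rw [e]; linarith
  have hG : G x y ^ 2 ≤ √(4 * x.2 * y.2 / ((x.1 - y.1) ^ 2 + (x.2 - y.2) ^ 2)) := by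
    unfold G
    rw [mul_pow]
    have hpi : (1 / (4 * π)) ^ 2 ≤ 1 / 16 := by
      have := Real.pi_gt_three
      rw [div_pow, div_le_div_iff₀ (by positivity) (by norm_num)]
      nlinarith
    calc _ ≤ 1 / 16 * Real.log (1 + 4 * x.2 * y.2 / ((x.1 - y.1) ^ 2 + (x.2 - y.2) ^ 2)) ^ 2 := by
          gcongr
      _ ≤ _ := by linarith
  have : 2 * x.2 * ρ⁻¹ ≤ 2 * x.2 * (1 + sing2 (x - y)) := by
    apply mul_le_mul_of_nonneg_left key (by linarith)
  linarith

lemma ae_fst_ne (c : ℝ) : ∀ᵐ y : ℝ × ℝ, c ≠ y.1 := by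
  have : ∀ᵐ t : ℝ, c ≠ t := by
    filter_upwards [Measure.ae_ne volume c] with t ht using ht.symm
  exact Measure.quasiMeasurePreserving_fst.ae this

lemma ae_snd_ne (c : ℝ) : ∀ᵐ y : ℝ × ℝ, c ≠ y.2 := by
  have : ∀ᵐ t : ℝ, c ≠ t := by
    filter_upwards [Measure.ae_ne volume c] with t ht using ht.symm
  exact Measure.quasiMeasurePreserving_snd.ae this

lemma ae_sq_G_le {A : Set (ℝ × ℝ)} (hA : MeasurableSet A) (hAH : A ⊆ H) {x : ℝ × ℝ} (hx : x ∈ H) :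
    ∀ᵐ y ∂volume.restrict A, G x y ^ 2 ≤ 1 + 2 * x.2 * (1 + sing2 (x - y)) := by
  filter_upwards [ae_restrict_mem hA, ae_restrict_of_ae (ae_fst_ne x.1),
    ae_restrict_of_ae (ae_snd_ne x.2)] with y hy h1 h2
  exact sq_G_le hx (hAH hy) h1 h2

lemma integrableOn_G_majorant {A : Set (ℝ × ℝ)} (hfin : volume A ≠ ⊤) (x : ℝ × ℝ) :
    IntegrableOn (fun y => 1 + 2 * x.2 * (1 + sing2 (x - y))) A := by
  have h1 : IntegrableOn (fun _ : ℝ × ℝ => (1 : ℝ)) A := integrableOn_const hfin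
  have h2 : IntegrableOn (fun y => sing2 (x - y)) A :=
    (integrable_sing2.comp_sub_left x).integrableOn
  exact h1.add ((h1.add h2).const_mul _)

lemma integrableOn_sq_G {A : Set (ℝ × ℝ)} (hA : MeasurableSet A) (hAH : A ⊆ H)
    (hfin : volume A ≠ ⊤) {x : ℝ × ℝ} (hx : x ∈ H) : IntegrableOn (fun y => G x y ^ 2) A := by
  refine (integrableOn_G_majorant hfin x).mono'
    ((measurable_G_right x).pow_const 2).aestronglyMeasurable ?_
  filter_upwards [ae_sq_G_le hA hAH hx] with y hy
  rw [Real.norm_of_nonneg (sq_nonneg _)]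
  exact hy

lemma setIntegral_sq_G_le {A : Set (ℝ × ℝ)} (hA : MeasurableSet A) (hAH : A ⊆ H)
    (hfin : volume A ≠ ⊤) {x : ℝ × ℝ} (hx : x ∈ H) :
    ∫ y in A, G x y ^ 2 ≤ volume.real A + 2 * x.2 * (volume.real A + ∫ w, sing2 w) := by
  have h1 : IntegrableOn (fun _ : ℝ × ℝ => (1 : ℝ)) A := integrableOn_const hfin
  have h2' : Integrable (fun y => sing2 (x - y)) := integrable_sing2.comp_sub_left x
  have h2 : IntegrableOn (fun y => sing2 (x - y)) A := h2'.integrableOn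
  have hx2 : 0 < x.2 := hx
  calc ∫ y in A, G x y ^ 2 ≤ ∫ y in A, (1 + 2 * x.2 * (1 + sing2 (x - y))) :=
        integral_mono_ae (integrableOn_sq_G hA hAH hfin hx) (integrableOn_G_majorant hfin x)
          (ae_sq_G_le hA hAH hx)
    _ = volume.real A + 2 * x.2 * (volume.real A + ∫ y in A, sing2 (x - y)) := by
        have h3 : IntegrableOn (fun y => 2 * x.2 * (1 + sing2 (x - y))) A :=
          (h1.add h2).const_mul _
        rw [integral_add h1 h3, integral_const_mul, integral_add h1 h2]
        simp
    _ ≤ _ := by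
        have : ∫ y in A, sing2 (x - y) ≤ ∫ w, sing2 w := by
          rw [← integral_sub_left_eq_self sing2 volume x]
          exact setIntegral_le_integral h2' (ae_of_all _ fun y => sing2_nonneg _)
        gcongr

lemma integrableOn_G {A : Set (ℝ × ℝ)} (hA : MeasurableSet A) (hAH : A ⊆ H)
    (hfin : volume A ≠ ⊤) {x : ℝ × ℝ} (hx : x ∈ H) : IntegrableOn (G x) A := by
  refine ((integrableOn_const hfin (C := (1 : ℝ))).add (integrableOn_sq_G hA hAH hfin hx)).mono'
    (measurable_G_right x).aestronglyMeasurable (ae_of_all _ fun y => ?_)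
  rw [Real.norm_eq_abs]
  simp only [Pi.add_apply]
  rw [← sq_abs]
  nlinarith [sq_nonneg (|G x y| - 1), abs_nonneg (G x y)]

lemma setIntegral_G_le {A : Set (ℝ × ℝ)} (hA : MeasurableSet A) (hAH : A ⊆ H)
    (hfin : volume A ≠ ⊤) {x : ℝ × ℝ} (hx : x ∈ H) :
    ∫ y in A, G x y ≤ 2 * volume.real A + 2 * x.2 * (volume.real A + ∫ w, sing2 w) := by
  have h1 : IntegrableOn (fun _ : ℝ × ℝ => (1 : ℝ)) A := integrableOn_const hfin
  have h2 := integrableOn_sq_G hA hAH hfin hx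
  have : ∫ y in A, G x y ≤ ∫ y in A, (1 + G x y ^ 2) := by
    refine integral_mono (integrableOn_G hA hAH hfin hx) (h1.add h2) fun y => ?_
    simp only
    nlinarith [sq_nonneg (G x y - 1)]
  rw [integral_add h1 h2] at this
  have h3 := setIntegral_sq_G_le hA hAH hfin hx
  simp only [integral_const, MeasurableSet.univ, measureReal_restrict_apply, univ_inter,
    smul_eq_mul, mul_one] at this
  linarith

/-! ### Continuity and decay of potentials -/

lemma tendsto_integral_of_sq_bounded {α ι : Type*} [MeasurableSpace α] {μ : Measure α}
    [IsFiniteMeasure μ] {l : Filter ι} [l.IsCountablyGenerated] {F : ι → α → ℝ} {C : ℝ}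
    (hm : ∀ n, AEStronglyMeasurable (F n) μ)
    (hF : ∀ᶠ n in l, Integrable (fun y => F n y ^ 2) μ ∧ ∫ y, F n y ^ 2 ∂μ ≤ C)
    (hlim : ∀ᵐ y ∂μ, Tendsto (fun n => F n y) l (𝓝 0)) :
    Tendsto (fun n => ∫ y, F n y ∂μ) l (𝓝 0) := by
  rw [Metric.tendsto_nhds]
  intro ε hε
  set N : ℝ := 2 * (|C| + 1) / ε with hN
  have hN0 : 0 < N := by positivity
  have hdct : Tendsto (fun n => ∫ y, min |F n y| N ∂μ) l (𝓝 (∫ _, (0 : ℝ) ∂μ)) := by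
    refine tendsto_integral_filter_of_dominated_convergence (fun _ => N) ?_ ?_
      (integrable_const _) ?_
    · exact Eventually.of_forall fun n => (hm n).norm.inf aestronglyMeasurable_const
    · refine Eventually.of_forall fun n => ae_of_all _ fun y => ?_
      rw [Real.norm_of_nonneg (le_min (abs_nonneg _) hN0.le)]
      exact min_le_right _ _
    · filter_upwards [hlim] with y hy
      have := (hy.abs).min (tendsto_const_nhds (x := N))
      simpa [hN0.le] using this
  rw [integral_zero, Metric.tendsto_nhds] at hdct
  filter_upwards [hF, hdct (ε / 2) (by positivity)] with n hn hn2
  have hint1 : Integrable (fun y => min |F n y| N) μ := by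
    refine (integrable_const N).mono' ((hm n).norm.inf aestronglyMeasurable_const)
      (ae_of_all _ fun y => ?_)
    rw [Real.norm_of_nonneg (le_min (abs_nonneg _) hN0.le)]
    exact min_le_right _ _
  have hint2 : Integrable (fun y => F n y ^ 2 / N) μ := hn.1.div_const N
  have hpt : ∀ y, |F n y| ≤ min |F n y| N + F n y ^ 2 / N := by
    intro y
    rcases le_total |F n y| N with h | h
    · rw [min_eq_left h]
      have : 0 ≤ F n y ^ 2 / N := by positivity
      linarith
    · rw [min_eq_right h]
      have : |F n y| ≤ F n y ^ 2 / N := by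
        rw [le_div_iff₀ hN0, ← sq_abs]
        nlinarith [abs_nonneg (F n y)]
      linarith
  have h1 : |∫ y, F n y ∂μ| ≤ ∫ y, (min |F n y| N + F n y ^ 2 / N) ∂μ := by
    rw [← Real.norm_eq_abs]
    exact norm_integral_le_of_norm_le (hint1.add hint2) (ae_of_all _ fun y => hpt y)
  rw [integral_add hint1 hint2, integral_div] at h1
  have h2 : (∫ y, F n y ^ 2 ∂μ) / N < ε / 2 := by
    rw [div_lt_iff₀ hN0, hN]
    have : ε / 2 * (2 * (|C| + 1) / ε) = |C| + 1 := by field_simp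
    rw [this]
    linarith [le_abs_self C, hn.2]
  rw [Real.dist_eq, sub_zero] at hn2 ⊢
  linarith [le_abs_self (∫ y, min |F n y| N ∂μ)]

lemma tendsto_setIntegral_G {ι : Type*} {l : Filter ι} [l.IsCountablyGenerated]
    {A : Set (ℝ × ℝ)} (hA : MeasurableSet A) (hAH : A ⊆ H) (hfin : volume A ≠ ⊤)
    {x : ι → ℝ × ℝ} {R : ℝ} (hx : ∀ᶠ n in l, x n ∈ H ∧ (x n).2 ≤ R)
    {g : ℝ × ℝ → ℝ} (hgm : Measurable g) (hg1 : IntegrableOn g A)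
    (hg2 : IntegrableOn (fun y => g y ^ 2) A)
    (hlim : ∀ᵐ y ∂volume.restrict A, Tendsto (fun n => G (x n) y) l (𝓝 (g y))) :
    Tendsto (fun n => ∫ y in A, G (x n) y) l (𝓝 (∫ y in A, g y)) := by
  have : IsFiniteMeasure (volume.restrict A) := ⟨by simpa using hfin.lt_top⟩
  have key : Tendsto (fun n => ∫ y in A, (G (x n) y - g y)) l (𝓝 0) := by
    set K := volume.real A + ∫ w, sing2 w with hK
    have hK0 : 0 ≤ K := add_nonneg measureReal_nonneg (integral_nonneg sing2_nonneg)
    refine tendsto_integral_of_sq_bounded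
      (C := 2 * (volume.real A + 2 * R * K) + 2 * ∫ y in A, g y ^ 2)
      (fun n => ((measurable_G_right _).sub hgm).aestronglyMeasurable) ?_ ?_
    · filter_upwards [hx] with n hn
      have hG2 := integrableOn_sq_G hA hAH hfin hn.1
      have hsum : IntegrableOn (fun y => 2 * G (x n) y ^ 2 + 2 * g y ^ 2) A :=
        (hG2.const_mul 2).add (hg2.const_mul 2)
      have hpt : ∀ y, (G (x n) y - g y) ^ 2 ≤ 2 * G (x n) y ^ 2 + 2 * g y ^ 2 := fun y => by
        nlinarith [sq_nonneg (G (x n) y + g y)]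
      have hint : IntegrableOn (fun y => (G (x n) y - g y) ^ 2) A := by
        refine hsum.mono' (((measurable_G_right _).sub hgm).pow_const 2).aestronglyMeasurable
          (ae_of_all _ fun y => ?_)
        rw [Real.norm_of_nonneg (sq_nonneg _)]
        exact hpt y
      refine ⟨hint, ?_⟩
      have h1 := integral_mono hint hsum hpt
      rw [integral_add (hG2.const_mul 2) (hg2.const_mul 2), integral_const_mul,
        integral_const_mul] at h1
      have h2 := setIntegral_sq_G_le hA hAH hfin hn.1
      rw [← hK] at h2
      nlinarith [mul_le_mul_of_nonneg_right hn.2 hK0]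
    · filter_upwards [hlim] with y hy
      simpa using hy.sub_const (g y)
  have h2 := key.add_const (∫ y in A, g y)
  rw [zero_add] at h2
  refine h2.congr' ?_
  filter_upwards [hx] with n hn
  rw [integral_sub (integrableOn_G hA hAH hfin hn.1) hg1, sub_add_cancel]

lemma continuousAt_G_left {x y : ℝ × ℝ} (hx : x ∈ H) (hy : y ∈ H) (h : x.1 ≠ y.1) :
    ContinuousAt (fun z => G z y) x := by
  have hd : (x.1 - y.1) ^ 2 + (x.2 - y.2) ^ 2 ≠ 0 := by
    have := sub_ne_zero.2 h
    positivity
  have hz := G_ratio_nonneg hx hy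
  unfold G
  refine continuousAt_const.mul (ContinuousAt.log ?_ (by linarith))
  refine continuousAt_const.add (ContinuousAt.div (by fun_prop) (by fun_prop) hd)

lemma continuousOn_setIntegral_G {A : Set (ℝ × ℝ)} (hA : MeasurableSet A) (hAH : A ⊆ H)
    (hfin : volume A ≠ ⊤) : ContinuousOn (fun x => ∫ y in A, G x y) H := by
  intro x hx
  refine tendsto_setIntegral_G hA hAH hfin (R := x.2 + 1) ?_ (measurable_G_right x)
    (integrableOn_G hA hAH hfin hx) (integrableOn_sq_G hA hAH hfin hx) ?_
  · have h1 : ∀ᶠ z : ℝ × ℝ in 𝓝 x, z.2 < x.2 + 1 :=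
      continuousAt_snd.eventually_lt_const (by linarith)
    filter_upwards [self_mem_nhdsWithin, h1.filter_mono nhdsWithin_le_nhds] with z h1 h2
    exact ⟨h1, h2.le⟩
  · filter_upwards [ae_restrict_mem hA, ae_restrict_of_ae (ae_fst_ne x.1)] with y hy h1
    exact (continuousAt_G_left hx (hAH hy) h1).continuousWithinAt

lemma tendsto_G_horizontal {s : ℝ} (y : ℝ × ℝ) :
    Tendsto (fun t : ℝ => G (t, s) y) atTop (𝓝 0) := by
  unfold G
  have h0 : Tendsto (fun t : ℝ => (t - y.1) ^ 2 + (s - y.2) ^ 2) atTop atTop := by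
    refine tendsto_atTop_add_const_right _ _ ?_
    exact (tendsto_pow_atTop two_ne_zero).comp (tendsto_atTop_add_const_right _ (-y.1) tendsto_id)
  have h1 : Tendsto (fun t : ℝ => 4 * s * y.2 / ((t - y.1) ^ 2 + (s - y.2) ^ 2)) atTop (𝓝 0) :=
    tendsto_const_nhds.div_atTop h0
  have h2 := (h1.const_add 1).log (by norm_num)
  simpa using h2.const_mul (1 / (4 * π))

lemma tendsto_setIntegral_G_horizontal {A : Set (ℝ × ℝ)} (hA : MeasurableSet A) (hAH : A ⊆ H)
    (hfin : volume A ≠ ⊤) {s : ℝ} (hs : 0 < s) :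
    Tendsto (fun t : ℝ => ∫ y in A, G (t, s) y) atTop (𝓝 0) := by
  have := tendsto_setIntegral_G hA hAH hfin (x := fun t : ℝ => (t, s)) (l := atTop) (R := s)
    (Eventually.of_forall fun t => ⟨hs, le_rfl⟩) (g := fun _ => 0) measurable_const
    integrableOn_zero (by simp) (ae_of_all _ fun y => tendsto_G_horizontal y)
  simpa using this

/-- On a horizontal line, the potential takes every positive value below its value at a point. -/
lemma exists_horizontal_eq {A : Set (ℝ × ℝ)} (hA : MeasurableSet A) (hAH : A ⊆ H)
    (hfin : volume A ≠ ⊤) {x : ℝ × ℝ} (hx : x ∈ H) {c : ℝ} (hc : 0 < c)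
    (hcx : c < ∫ y in A, G x y) : ∃ t : ℝ, ∫ y in A, G (t, x.2) y = c := by
  set f : ℝ → ℝ := fun t => ∫ y in A, G (t, x.2) y with hf
  have hcont : Continuous f := by
    rw [← continuousOn_univ]
    exact (continuousOn_setIntegral_G hA hAH hfin).comp
      (f := fun t : ℝ => ((t, x.2) : ℝ × ℝ)) (by fun_prop) (fun t _ => hx)
  obtain ⟨t, ht⟩ := ((tendsto_setIntegral_G_horizontal hA hAH hfin
    (show 0 < x.2 from hx)).eventually_lt_const hc).exists
  exact mem_range_of_exists_le_of_exists_ge hcont ⟨t, ht.le⟩ ⟨x.1, hcx.le⟩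

/-! ### Uniqueness of the constants -/

lemma isOpen_H : IsOpen H := isOpen_lt continuous_const continuous_snd

lemma superlevel_no_gap {f : ℝ × ℝ → ℝ} (hf : ContinuousOn f H) {a b a' b' : ℝ}
    (h : ∀ᵐ x ∂volume.restrict H, (a * x.2 + b < f x ↔ a' * x.2 + b' < f x))
    {x : ℝ × ℝ} (hx : x ∈ H) (h1 : a * x.2 + b < f x) (h2 : f x < a' * x.2 + b') : False := by
  have ho : IsOpen {z ∈ H | a * z.2 + b < f z ∧ f z < a' * z.2 + b'} := by
    have e : {z ∈ H | a * z.2 + b < f z ∧ f z < a' * z.2 + b'} =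
        (H ∩ (fun z => f z - (a * z.2 + b)) ⁻¹' Ioi 0) ∩
          (H ∩ (fun z => (a' * z.2 + b') - f z) ⁻¹' Ioi 0) := by
      ext z
      simp only [mem_ofPred_eq, mem_inter_iff, mem_preimage, mem_Ioi, sub_pos]
      tauto
    rw [e]
    refine (ContinuousOn.isOpen_inter_preimage ?_ isOpen_H isOpen_Ioi).inter
      (ContinuousOn.isOpen_inter_preimage ?_ isOpen_H isOpen_Ioi)
    · exact hf.sub (by fun_prop)
    · exact ContinuousOn.sub (by fun_prop) hf
  have hpos := ho.measure_pos volume ⟨x, hx, h1, h2⟩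
  rw [ae_restrict_iff' measurableSet_H] at h
  refine hpos.ne' (measure_mono_null (fun z hz => ?_) h)
  simp only [mem_compl_iff, mem_ofPred_eq, not_forall]
  exact ⟨hz.1, fun hiff => lt_asymm hz.2.2 (hiff.1 hz.2.1)⟩

lemma volume_height_eq (h : ℝ) : volume {x : ℝ × ℝ | x.2 = h} = 0 := by
  have := ae_snd_ne h
  rw [ae_iff] at this
  simpa [eq_comm] using this

lemma superlevel_constants_unique {A : Set (ℝ × ℝ)} (hA : MeasurableSet A) (hAH : A ⊆ H)
    (hfin : volume A ≠ ⊤) (hA0 : volume A ≠ 0) {W γ W' γ' : ℝ} (hW : 0 < W) (hγ : 0 ≤ γ)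
    (h1 : ∀ᵐ x ∂volume.restrict H, (x ∈ A ↔ W * x.2 + γ < ∫ y in A, G x y))
    (h2 : ∀ᵐ x ∂volume.restrict H, (x ∈ A ↔ W' * x.2 + γ' < ∫ y in A, G x y)) :
    W' = W ∧ γ' = γ := by
  have hf := continuousOn_setIntegral_G hA hAH hfin
  have h12 : ∀ᵐ x ∂volume.restrict H,
      (W * x.2 + γ < ∫ y in A, G x y ↔ W' * x.2 + γ' < ∫ y in A, G x y) := by
    filter_upwards [h1, h2] with x hx hx' using hx.symm.trans hx'
  have h21 : ∀ᵐ x ∂volume.restrict H,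
      (W' * x.2 + γ' < ∫ y in A, G x y ↔ W * x.2 + γ < ∫ y in A, G x y) := by
    filter_upwards [h12] with x hx using hx.symm
  have key : ∀ x ∈ H, W * x.2 + γ < ∫ y in A, G x y → W * x.2 + γ = W' * x.2 + γ' := by
    intro x hx hfx
    have hx2 : 0 < x.2 := hx
    have hpos : 0 < W * x.2 + γ := by positivity
    rcases lt_trichotomy (W * x.2 + γ) (W' * x.2 + γ') with hlt | heq | hgt
    · exfalso
      obtain ⟨c, hc1, hc2⟩ := exists_between (lt_min hfx hlt)
      obtain ⟨t, ht⟩ := exists_horizontal_eq hA hAH hfin hx (hpos.trans hc1)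
        (hc2.trans_le (min_le_left _ _))
      exact superlevel_no_gap hf h12 (x := (t, x.2)) hx (by simpa only [ht] using hc1)
        (by simpa only [ht] using hc2.trans_le (min_le_right _ _))
    · exact heq
    · exfalso
      obtain ⟨c, hc1, hc2⟩ := exists_between (max_lt hpos hgt)
      obtain ⟨t, ht⟩ := exists_horizontal_eq hA hAH hfin hx
        ((le_max_left _ _).trans_lt hc1) (hc2.trans hfx)
      exact superlevel_no_gap hf h21 (x := (t, x.2)) hx
        (by simpa only [ht] using (le_max_right _ _).trans_lt hc1) (by simpa only [ht] using hc2)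
  have hline : ∀ᵐ x ∂volume.restrict A, W * x.2 + γ = W' * x.2 + γ' := by
    have h3 := ae_restrict_of_ae_restrict_of_subset hAH h1
    filter_upwards [h3, ae_restrict_mem hA] with x hx hxA
    exact key x (hAH hxA) (hx.1 hxA)
  by_cases hWW : W' = W
  · refine ⟨hWW, ?_⟩
    have : (ae (volume.restrict A)).NeBot := by
      rw [ae_neBot, Ne, Measure.restrict_eq_zero]; exact hA0
    obtain ⟨x, hx⟩ := hline.exists
    rw [hWW] at hx
    linarith
  · exfalso
    have hne := sub_ne_zero.2 hWW
    have h4 : ∀ᵐ x ∂volume.restrict A, x.2 = (γ - γ') / (W' - W) := by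
      filter_upwards [hline] with x hx
      rw [eq_div_iff hne]
      linarith
    have h5 : ∀ᵐ x ∂volume.restrict A, x.2 ≠ (γ - γ') / (W' - W) := by
      refine ae_restrict_of_ae ?_
      rw [ae_iff]
      simpa using volume_height_eq ((γ - γ') / (W' - W))
    have : (ae (volume.restrict A)).NeBot := by
      rw [ae_neBot, Ne, Measure.restrict_eq_zero]; exact hA0
    obtain ⟨x, hx, hx'⟩ := (h4.and h5).exists
    exact hx' hx

/-! ### Pair interactions of planar sets -/

/-- Measurable subsets of the half plane with finite area and finite impulse. -/
structure IsPatch (A : Set (ℝ × ℝ)) : Prop where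
  subset_H : A ⊆ H
  meas : MeasurableSet A
  fin : volume A ≠ ⊤
  imp : IntegrableOn (fun x : ℝ × ℝ => x.2) A

lemma IsPatch.mono {A B : Set (ℝ × ℝ)} (hA : IsPatch A) (hB : MeasurableSet B) (hBA : B ⊆ A) :
    IsPatch B :=
  ⟨hBA.trans hA.subset_H, hB, measure_ne_top_of_subset hBA hA.fin, hA.imp.mono_set hBA⟩

lemma IsPatch.union {A B : Set (ℝ × ℝ)} (hA : IsPatch A) (hB : IsPatch B) : IsPatch (A ∪ B) :=
  ⟨union_subset hA.subset_H hB.subset_H, hA.meas.union hB.meas,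
    measure_union_ne_top hA.fin hB.fin, hA.imp.union hB.imp⟩

/-- The interaction `∫_S ∫_T g(x,y) dy dx`, as an integral over the product. -/
def pairInt (g : ℝ × ℝ → ℝ × ℝ → ℝ) (S T : Set (ℝ × ℝ)) : ℝ := ∫ p in S ×ˢ T, g p.1 p.2

lemma pairInt_eq {g : ℝ × ℝ → ℝ × ℝ → ℝ} {S T : Set (ℝ × ℝ)}
    (h : IntegrableOn (fun p : (ℝ × ℝ) × (ℝ × ℝ) => g p.1 p.2) (S ×ˢ T)) :
    pairInt g S T = ∫ x in S, ∫ y in T, g x y := by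
  unfold pairInt
  rw [Measure.volume_eq_prod] at h ⊢
  exact setIntegral_prod _ h

lemma pairInt_comm {g : ℝ × ℝ → ℝ × ℝ → ℝ} (hg : ∀ x y, g x y = g y x) (S T : Set (ℝ × ℝ)) :
    pairInt g S T = pairInt g T S := by
  unfold pairInt
  rw [Measure.volume_eq_prod, ← setIntegral_prod_swap T S (fun p => g p.1 p.2)]
  simp only [Prod.fst_swap, Prod.snd_swap]
  congr 1
  ext p
  exact hg _ _

lemma pairInt_union_left {g : ℝ × ℝ → ℝ × ℝ → ℝ} {S T U : Set (ℝ × ℝ)} (hT : MeasurableSet T)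
    (hU : MeasurableSet U) (hST : Disjoint S T)
    (h1 : IntegrableOn (fun p : (ℝ × ℝ) × (ℝ × ℝ) => g p.1 p.2) (S ×ˢ U))
    (h2 : IntegrableOn (fun p : (ℝ × ℝ) × (ℝ × ℝ) => g p.1 p.2) (T ×ˢ U)) :
    pairInt g (S ∪ T) U = pairInt g S U + pairInt g T U := by
  unfold pairInt
  rw [union_prod, setIntegral_union (hST.set_prod_left _ _) (hT.prod hU) h1 h2]

lemma pairInt_union_self {g : ℝ × ℝ → ℝ × ℝ → ℝ} (hg : ∀ x y, g x y = g y x)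
    {S T : Set (ℝ × ℝ)} (hS : MeasurableSet S) (hT : MeasurableSet T) (hST : Disjoint S T)
    (h : IntegrableOn (fun p : (ℝ × ℝ) × (ℝ × ℝ) => g p.1 p.2) ((S ∪ T) ×ˢ (S ∪ T))) :
    pairInt g (S ∪ T) (S ∪ T) = pairInt g S S + 2 * pairInt g T S + pairInt g T T := by
  have hl := subset_union_left (s := S) (t := T)
  have hr := subset_union_right (s := S) (t := T)
  rw [pairInt_union_left hT (hS.union hT) hST (h.mono_set (prod_mono hl Subset.rfl))
      (h.mono_set (prod_mono hr Subset.rfl)), pairInt_comm hg S, pairInt_comm hg T,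
    pairInt_union_left hT hS hST (h.mono_set (prod_mono hl hl)) (h.mono_set (prod_mono hr hl)),
    pairInt_union_left hT hT hST (h.mono_set (prod_mono hl hr)) (h.mono_set (prod_mono hr hr)),
    pairInt_comm hg S T]
  ring

lemma pairInt_nonneg {g : ℝ × ℝ → ℝ × ℝ → ℝ} (hg : ∀ x ∈ H, ∀ y ∈ H, 0 ≤ g x y)
    {S T : Set (ℝ × ℝ)} (hS : IsPatch S) (hT : IsPatch T) : 0 ≤ pairInt g S T :=
  setIntegral_nonneg (hS.meas.prod hT.meas)
    fun _ hp => hg _ (hS.subset_H hp.1) _ (hT.subset_H hp.2)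

lemma IsPatch.integrableOn_G {S T : Set (ℝ × ℝ)} (hS : IsPatch S) (hT : IsPatch T) :
    IntegrableOn (fun p : (ℝ × ℝ) × (ℝ × ℝ) => G p.1 p.2) (S ×ˢ T) := by
  unfold IntegrableOn
  rw [Measure.volume_eq_prod, ← Measure.prod_restrict,
    integrable_prod_iff measurable_G.aestronglyMeasurable]
  refine ⟨?_, ?_⟩
  · filter_upwards [ae_restrict_mem hS.meas] with x hx
    exact _root_.integrableOn_G hT.meas hT.subset_H hT.fin (hS.subset_H hx)
  · have hbound : IntegrableOn (fun x : ℝ × ℝ =>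
        2 * volume.real T + 2 * x.2 * (volume.real T + ∫ w, sing2 w)) S :=
      (integrableOn_const hS.fin).add ((hS.imp.const_mul 2).mul_const _)
    refine hbound.mono'
      (measurable_G.norm.stronglyMeasurable.integral_prod_right
        (ν := volume.restrict T)).aestronglyMeasurable ?_
    filter_upwards [ae_restrict_mem hS.meas] with x hx
    have e : ∫ y in T, ‖G x y‖ = ∫ y in T, G x y :=
      setIntegral_congr_fun hT.meas fun y hy =>
        Real.norm_of_nonneg (G_nonneg (hS.subset_H hx) (hT.subset_H hy))
    rw [Real.norm_of_nonneg (integral_nonneg fun y => norm_nonneg _), e]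
    exact setIntegral_G_le hT.meas hT.subset_H hT.fin (hS.subset_H hx)

lemma pairInt_G_eq {S T : Set (ℝ × ℝ)} (hS : IsPatch S) (hT : IsPatch T) :
    pairInt G S T = ∫ x in S, ∫ y in T, G x y :=
  pairInt_eq (hS.integrableOn_G hT)

lemma IsPatch.integrableOn_pot {S T : Set (ℝ × ℝ)} (hS : IsPatch S) (hT : IsPatch T) :
    IntegrableOn (fun x => ∫ y in T, G x y) S := by
  have h := hS.integrableOn_G hT
  unfold IntegrableOn at h ⊢
  rw [Measure.volume_eq_prod, ← Measure.prod_restrict] at h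
  exact h.integral_prod_left

/-- Twice the rate of change of the Green function under area-preserving shears
`(x₁, x₂) ↦ (x₁ / s, s x₂)`, up to a constant factor. -/
def shearKernel (x y : ℝ × ℝ) : ℝ :=
  (1 / (4 * π)) * ((x.1 - y.1) ^ 2 * (4 * x.2 * y.2) /
    (((x.1 - y.1) ^ 2 + (x.2 - y.2) ^ 2) *
      ((x.1 - y.1) ^ 2 + (x.2 - y.2) ^ 2 + 4 * x.2 * y.2)))

lemma shearKernel_comm (x y : ℝ × ℝ) : shearKernel x y = shearKernel y x := by
  unfold shearKernel
  congr 2 <;> ring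

lemma measurable_shearKernel :
    Measurable (fun p : (ℝ × ℝ) × (ℝ × ℝ) => shearKernel p.1 p.2) := by
  unfold shearKernel; fun_prop

lemma shearKernel_nonneg {x y : ℝ × ℝ} (hx : x ∈ H) (hy : y ∈ H) : 0 ≤ shearKernel x y := by
  have h1 : 0 < x.2 := hx
  have h2 : 0 < y.2 := hy
  unfold shearKernel
  positivity

lemma shearKernel_pos {x y : ℝ × ℝ} (hx : x ∈ H) (hy : y ∈ H) (h : x.1 ≠ y.1) :
    0 < shearKernel x y := by
  have h1 : 0 < x.2 := hx
  have h2 : 0 < y.2 := hy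
  have h3 := sub_ne_zero.2 h
  unfold shearKernel
  positivity

lemma shearKernel_le_one {x y : ℝ × ℝ} (hx : x ∈ H) (hy : y ∈ H) : shearKernel x y ≤ 1 := by
  have h1 : 0 < x.2 := hx
  have h2 : 0 < y.2 := hy
  have hc : 0 < 4 * x.2 * y.2 := by positivity
  unfold shearKernel
  set a := (x.1 - y.1) ^ 2 with ha
  set b := (x.2 - y.2) ^ 2 with hb
  set c := 4 * x.2 * y.2 with hc'
  have ha0 : 0 ≤ a := sq_nonneg _
  have hb0 : 0 ≤ b := sq_nonneg _
  have hk : a * c / ((a + b) * (a + b + c)) ≤ 1 := by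
    apply div_le_one_of_le₀ _ (by positivity)
    nlinarith [mul_nonneg ha0 hb0, mul_nonneg hb0 hc.le, sq_nonneg (a + b)]
  have hpi : 1 / (4 * π) ≤ 1 := by
    rw [div_le_one (by positivity)]
    linarith [Real.pi_gt_three]
  exact mul_le_one₀ hpi (by positivity) hk

lemma IsPatch.integrableOn_shearKernel {S T : Set (ℝ × ℝ)} (hS : IsPatch S) (hT : IsPatch T) :
    IntegrableOn (fun p : (ℝ × ℝ) × (ℝ × ℝ) => shearKernel p.1 p.2) (S ×ˢ T) := by
  have hfin : volume (S ×ˢ T) ≠ ⊤ := by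
    rw [Measure.volume_eq_prod, Measure.prod_prod]
    exact ENNReal.mul_ne_top hS.fin hT.fin
  refine (integrableOn_const hfin (C := (1 : ℝ))).mono'
    measurable_shearKernel.aestronglyMeasurable ?_
  filter_upwards [ae_restrict_mem (hS.meas.prod hT.meas)] with p hp
  rw [Real.norm_of_nonneg (shearKernel_nonneg (hS.subset_H hp.1) (hT.subset_H hp.2))]
  exact shearKernel_le_one (hS.subset_H hp.1) (hT.subset_H hp.2)

lemma pairInt_shearKernel_le {S T : Set (ℝ × ℝ)} (hS : IsPatch S) (hT : IsPatch T) :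
    pairInt shearKernel S T ≤ volume.real S * volume.real T := by
  have hfin : volume (S ×ˢ T) ≠ ⊤ := by
    rw [Measure.volume_eq_prod, Measure.prod_prod]
    exact ENNReal.mul_ne_top hS.fin hT.fin
  have h := setIntegral_mono_on (hS.integrableOn_shearKernel hT) (integrableOn_const hfin)
    (hS.meas.prod hT.meas)
    fun p hp => shearKernel_le_one (hS.subset_H hp.1) (hT.subset_H hp.2)
  simpa [pairInt, Measure.volume_eq_prod, measureReal_prod_prod] using h

lemma pairInt_shearKernel_pos {S : Set (ℝ × ℝ)} (hS : IsPatch S) (h0 : volume S ≠ 0) :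
    0 < pairInt shearKernel S S := by
  have hnn : 0 ≤ᵐ[volume.restrict (S ×ˢ S)]
      (fun p : (ℝ × ℝ) × (ℝ × ℝ) => shearKernel p.1 p.2) := by
    filter_upwards [ae_restrict_mem (hS.meas.prod hS.meas)] with p hp
    exact shearKernel_nonneg (hS.subset_H hp.1) (hS.subset_H hp.2)
  refine lt_of_le_of_ne (integral_nonneg_of_ae hnn) fun h => ?_
  have hz := (integral_eq_zero_iff_of_nonneg_ae hnn (hS.integrableOn_shearKernel hS)).1 h.symm
  have hne : ∀ᵐ p : (ℝ × ℝ) × (ℝ × ℝ), p.1.1 ≠ p.2.1 := by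
    rw [Measure.volume_eq_prod]
    refine (Measure.ae_prod_iff_ae_ae ?_).2 (ae_of_all _ fun x => ae_fst_ne x.1)
    exact (measurableSet_eq_fun (by fun_prop) (by fun_prop)).compl
  have hF : ∀ᵐ p ∂volume.restrict (S ×ˢ S), False := by
    filter_upwards [hz, ae_restrict_of_ae hne, ae_restrict_mem (hS.meas.prod hS.meas)]
      with p h1 h2 h3
    exact (shearKernel_pos (hS.subset_H h3.1) (hS.subset_H h3.2) h2).ne' h1
  have : volume (S ×ˢ S) = 0 := by
    simpa [ae_iff] using hF
  rw [Measure.volume_eq_prod, Measure.prod_prod] at this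
  exact h0 (mul_self_eq_zero.1 this)

/-! ### Comparison through diagonal stretchings -/

lemma log_one_add_div_ge {a b c q : ℝ} (ha : 0 ≤ a) (hb : 0 ≤ b) (hab : 0 < a + b) (hc : 0 < c)
    (hq : 0 < q) :
    Real.log (1 + c / (a + b)) - (q - 1) * (a * c / ((a + b) * (a + b + c))) ≤
      Real.log (1 + c / (q * a + b)) := by
  have hqab : 0 < q * a + b := by
    rcases ha.eq_or_lt with h | h
    · rw [← h] at hab ⊢; linarith
    · positivity
  have hX : 0 < (1 + c / (q * a + b)) / (1 + c / (a + b)) := by positivity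
  have h1 := Real.one_sub_inv_le_log_of_pos hX
  rw [Real.log_div (by positivity) (by positivity)] at h1
  have h2 : 1 - ((1 + c / (q * a + b)) / (1 + c / (a + b)))⁻¹ =
      -((q - 1) * (a * c / ((a + b) * (q * a + b + c)))) := by
    field_simp
    ring
  have h3 : (q - 1) * (a * c / ((a + b) * (q * a + b + c))) ≤
      (q - 1) * (a * c / ((a + b) * (a + b + c))) := by
    rcases le_total 1 q with h | h
    · apply mul_le_mul_of_nonneg_left _ (by linarith)
      gcongr
      nlinarith
    · apply mul_le_mul_of_nonpos_left _ (by linarith)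
      gcongr
      nlinarith
  linarith

/-- The diagonal linear map `(x₁, x₂) ↦ (a x₁, b x₂)`. -/
def stretch (a b : ℝ) : ℝ × ℝ → ℝ × ℝ := Prod.map (a * ·) (b * ·)

lemma measurable_stretch (a b : ℝ) : Measurable (stretch a b) := by
  unfold stretch; fun_prop

lemma G_stretch_sub_le {a b : ℝ} (ha : 0 < a) (hb : 0 < b) {x y : ℝ × ℝ} (hx : x ∈ H)
    (hy : y ∈ H) :
    G (stretch a b x) (stretch a b y) -
      ((b / a) ^ 2 - 1) * shearKernel (stretch a b x) (stretch a b y) ≤ G x y := by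
  have h1 : 0 < x.2 := hx
  have h2 : 0 < y.2 := hy
  by_cases hxy : x.1 = y.1 ∧ x.2 = y.2
  · have e : x = y := Prod.ext hxy.1 hxy.2
    subst e
    simp [G, shearKernel]
  have hpos : 0 < (a * x.1 - a * y.1) ^ 2 + (b * x.2 - b * y.2) ^ 2 := by
    rw [← mul_sub, ← mul_sub]
    rcases not_and_or.1 hxy with h | h
    · have := sub_ne_zero.2 h
      positivity
    · have := sub_ne_zero.2 h
      positivity
  have key := log_one_add_div_ge (sq_nonneg (a * x.1 - a * y.1)) (sq_nonneg (b * x.2 - b * y.2))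
    hpos (show 0 < 4 * (b * x.2) * (b * y.2) by positivity) (show 0 < (b / a) ^ 2 by positivity)
  have e : 4 * (b * x.2) * (b * y.2) /
      ((b / a) ^ 2 * (a * x.1 - a * y.1) ^ 2 + (b * x.2 - b * y.2) ^ 2) =
      4 * x.2 * y.2 / ((x.1 - y.1) ^ 2 + (x.2 - y.2) ^ 2) := by
    have e1 : (b / a) ^ 2 * (a * x.1 - a * y.1) ^ 2 + (b * x.2 - b * y.2) ^ 2 =
        b ^ 2 * ((x.1 - y.1) ^ 2 + (x.2 - y.2) ^ 2) := by
      field_simp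
    rw [e1, show 4 * (b * x.2) * (b * y.2) = b ^ 2 * (4 * x.2 * y.2) by ring,
      mul_div_mul_left _ _ (by positivity)]
  rw [e] at key
  have := mul_le_mul_of_nonneg_left key (show 0 ≤ 1 / (4 * π) by positivity)
  simp only [G, shearKernel, stretch, Prod.map_fst, Prod.map_snd]
  linarith

lemma map_stretch_volume {a b : ℝ} (ha : 0 < a) (hb : 0 < b) :
    Measure.map (stretch a b) volume = ENNReal.ofReal (a * b)⁻¹ • volume := by
  unfold stretch
  rw [Measure.volume_eq_prod, ← Measure.map_prod_map _ _ (measurable_const_mul a)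
    (measurable_const_mul b), Real.map_volume_mul_left ha.ne', Real.map_volume_mul_left hb.ne',
    Measure.prod_smul_left, Measure.prod_smul_right, smul_smul, mul_inv,
    ENNReal.ofReal_mul (by positivity), abs_of_pos (inv_pos.2 ha), abs_of_pos (inv_pos.2 hb)]

lemma map_stretch_prod_volume {a b : ℝ} (ha : 0 < a) (hb : 0 < b) :
    Measure.map (Prod.map (stretch a b) (stretch a b)) volume =
      (ENNReal.ofReal (a * b)⁻¹ * ENNReal.ofReal (a * b)⁻¹) • volume := by
  rw [Measure.volume_eq_prod, ← Measure.map_prod_map _ _ (measurable_stretch a b)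
    (measurable_stretch a b), map_stretch_volume ha hb,
    Measure.prod_smul_left, Measure.prod_smul_right, smul_smul]

section Stretch

variable {a b : ℝ} {A : Set (ℝ × ℝ)}

lemma volume_stretch_preimage (ha : 0 < a) (hb : 0 < b) (hA : MeasurableSet A) :
    volume (stretch a b ⁻¹' A) = ENNReal.ofReal (a * b)⁻¹ * volume A := by
  rw [← Measure.map_apply (measurable_stretch a b) hA, map_stretch_volume ha hb]
  simp

lemma impulse_stretch_preimage (ha : 0 < a) (hb : 0 < b) (hA : MeasurableSet A) :
    ∫ x in stretch a b ⁻¹' A, x.2 = (a * b)⁻¹ * b⁻¹ * ∫ x in A, x.2 := by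
  have h := setIntegral_map (μ := volume) hA (f := fun x : ℝ × ℝ => b⁻¹ * x.2)
    (by fun_prop) (measurable_stretch a b).aemeasurable
  have e : ∀ x : ℝ × ℝ, b⁻¹ * (stretch a b x).2 = x.2 := fun x => by
    simp only [stretch, Prod.map_snd]; field_simp
  simp only [e] at h
  rw [← h, map_stretch_volume ha hb, Measure.restrict_smul, integral_smul_measure,
    integral_const_mul, ENNReal.toReal_ofReal (by positivity), smul_eq_mul]
  ring

lemma IsPatch.stretch_preimage (ha : 0 < a) (hb : 0 < b) (hA : IsPatch A) :
    IsPatch (stretch a b ⁻¹' A) := by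
  refine ⟨fun x hx => ?_, measurable_stretch a b hA.meas, ?_, ?_⟩
  · have : 0 < b * x.2 := hA.subset_H hx
    exact pos_of_mul_pos_right this hb.le
  · rw [volume_stretch_preimage ha hb hA.meas]
    exact ENNReal.mul_ne_top ENNReal.ofReal_ne_top hA.fin
  · have h : IntegrableOn (fun x : ℝ × ℝ => b⁻¹ * x.2) A (Measure.map (stretch a b) volume) := by
      rw [map_stretch_volume ha hb, IntegrableOn, Measure.restrict_smul]
      exact Integrable.smul_measure (hA.imp.const_mul _) ENNReal.ofReal_ne_top
    unfold IntegrableOn at h ⊢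
    rw [Measure.restrict_map (measurable_stretch a b) hA.meas,
      integrable_map_measure (by fun_prop) (measurable_stretch a b).aemeasurable] at h
    refine h.congr (ae_of_all _ fun x => ?_)
    simp only [Function.comp, stretch, Prod.map_snd]
    field_simp

lemma pairInt_stretch_preimage (ha : 0 < a) (hb : 0 < b) (hA : IsPatch A) :
    ((a * b)⁻¹) ^ 2 * (pairInt G A A - ((b / a) ^ 2 - 1) * pairInt shearKernel A A) ≤
      pairInt G (stretch a b ⁻¹' A) (stretch a b ⁻¹' A) := by
  have hS := hA.stretch_preimage ha hb
  have hG := hA.integrableOn_G hA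
  have hk := hA.integrableOn_shearKernel hA
  set F : (ℝ × ℝ) × (ℝ × ℝ) → ℝ := fun p => G p.1 p.2 - ((b / a) ^ 2 - 1) * shearKernel p.1 p.2
    with hF
  have hFm : Measurable F := measurable_G.sub (measurable_shearKernel.const_mul _)
  have hFint : IntegrableOn F (A ×ˢ A) := hG.sub (hk.const_mul _)
  have hLm : Measurable (Prod.map (stretch a b) (stretch a b)) :=
    (measurable_stretch a b).prodMap (measurable_stretch a b)
  have hpre : (stretch a b ⁻¹' A) ×ˢ (stretch a b ⁻¹' A) =
      Prod.map (stretch a b) (stretch a b) ⁻¹' (A ×ˢ A) := rfl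
  have h1 : ∫ p in A ×ˢ A, F p = pairInt G A A - ((b / a) ^ 2 - 1) * pairInt shearKernel A A := by
    rw [hF, integral_sub hG (hk.const_mul _), integral_const_mul]
    rfl
  have h2 := setIntegral_map (μ := volume) (hA.meas.prod hA.meas) (f := F)
    hFm.aestronglyMeasurable hLm.aemeasurable
  rw [map_stretch_prod_volume ha hb, Measure.restrict_smul, integral_smul_measure, h1,
    ENNReal.toReal_mul, ENNReal.toReal_ofReal (by positivity), smul_eq_mul, ← sq] at h2
  rw [h2]
  have hint : IntegrableOn F (A ×ˢ A)
      (Measure.map (Prod.map (stretch a b) (stretch a b)) volume) := by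
    rw [map_stretch_prod_volume ha hb, IntegrableOn, Measure.restrict_smul]
    exact Integrable.smul_measure hFint (ENNReal.mul_ne_top ENNReal.ofReal_ne_top
      ENNReal.ofReal_ne_top)
  unfold IntegrableOn at hint
  rw [Measure.restrict_map hLm (hA.meas.prod hA.meas),
    integrable_map_measure hFm.aestronglyMeasurable hLm.aemeasurable] at hint
  unfold pairInt
  rw [hpre]
  refine setIntegral_mono_on hint (hpre ▸ hS.integrableOn_G hS)
    (hLm (hA.meas.prod hA.meas)) fun p hp => ?_
  exact G_stretch_sub_le ha hb (hS.subset_H hp.1) (hS.subset_H hp.2)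

end Stretch

/-! ### First variation of a maximizer -/

lemma abs_inv_pow_mul_pow_sub_le {η d : ℝ} (hη : |η| ≤ 1 / 2) (hd : |d| ≤ 1 / 2) :
    |((1 + η) ^ 6)⁻¹ * (1 + d) ^ 4 - 1 + 6 * η - 4 * d| ≤ 40000 * (η ^ 2 + d ^ 2) := by
  obtain ⟨hη1, hη2⟩ := abs_le.1 hη
  obtain ⟨hd1, hd2⟩ := abs_le.1 hd
  set X := ((1 + η) ^ 6)⁻¹ - 1 + 6 * η with hX
  set Y := (1 + d) ^ 4 - 1 - 4 * d with hY
  have hXb : |X| ≤ 6144 * η ^ 2 := by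
    have hw : (1 / 64 : ℝ) ≤ (1 + η) ^ 6 := by
      calc (1 / 64 : ℝ) = (1 / 2) ^ 6 := by norm_num
        _ ≤ (1 + η) ^ 6 := by gcongr; linarith
    have hw0 : 0 < (1 + η) ^ 6 := by linarith
    have e : X = η ^ 2 * (21 + 70 * η + 105 * η ^ 2 + 84 * η ^ 3 + 35 * η ^ 4 + 6 * η ^ 5) *
        ((1 + η) ^ 6)⁻¹ := by
      rw [hX, ← div_eq_mul_inv, eq_div_iff hw0.ne']
      have : ((1 + η) ^ 6)⁻¹ * (1 + η) ^ 6 = 1 := inv_mul_cancel₀ hw0.ne'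
      linear_combination this
    have hinv : ((1 + η) ^ 6)⁻¹ ≤ 64 := by
      rw [inv_le_comm₀ hw0 (by norm_num)]
      linarith
    have hpow : ∀ n : ℕ, |η ^ n| ≤ (1 / 2) ^ n := fun n => by
      rw [abs_pow]; gcongr
    have h2 := abs_le.1 (hpow 2)
    have h3 := abs_le.1 (hpow 3)
    have h4 := abs_le.1 (hpow 4)
    have h5 := abs_le.1 (hpow 5)
    have hp : |21 + 70 * η + 105 * η ^ 2 + 84 * η ^ 3 + 35 * η ^ 4 + 6 * η ^ 5| ≤ 96 := by
      rw [abs_le]; constructor <;> linarith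
    rw [e, abs_mul, abs_mul, abs_of_nonneg (sq_nonneg η), abs_of_pos (inv_pos.2 hw0)]
    calc _ ≤ η ^ 2 * 96 * 64 := by gcongr
      _ = 6144 * η ^ 2 := by ring
  have hYb : |Y| ≤ 9 * d ^ 2 := by
    have e : Y = d ^ 2 * (6 + 4 * d + d ^ 2) := by rw [hY]; ring
    rw [e, abs_mul, abs_of_nonneg (sq_nonneg d), mul_comm]
    gcongr
    rw [abs_le]; constructor <;> nlinarith
  have hYb' : |Y| ≤ 3 := by nlinarith
  have e : ((1 + η) ^ 6)⁻¹ * (1 + d) ^ 4 - 1 + 6 * η - 4 * d =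
      -24 * (η * d) + (1 - 6 * η) * Y + X * (1 + 4 * d + Y) := by
    have h1 : ((1 + η) ^ 6)⁻¹ = X + 1 - 6 * η := by rw [hX]; ring
    have h2 : (1 + d) ^ 4 = Y + 1 + 4 * d := by rw [hY]; ring
    rw [h1, h2]; ring
  have t1 : |-24 * (η * d)| ≤ 12 * (η ^ 2 + d ^ 2) := by
    rw [abs_le]; constructor <;> nlinarith [sq_nonneg (η - d), sq_nonneg (η + d)]
  have t2 : |(1 - 6 * η) * Y| ≤ 4 * (9 * d ^ 2) := by
    rw [abs_mul]
    gcongr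
    rw [abs_le]; constructor <;> linarith
  have t3 : |X * (1 + 4 * d + Y)| ≤ 6144 * η ^ 2 * 6 := by
    rw [abs_mul]
    gcongr
    obtain ⟨h1, h2⟩ := abs_le.1 hYb'
    rw [abs_le]; constructor <;> linarith
  rw [e]
  refine (abs_add_three _ _ _).trans ?_
  nlinarith [sq_nonneg η, sq_nonneg d]

/-- Second-order estimate for the energy gain allowed by the scaling comparison. -/
lemma gain_le_of_comparison {P P' J J' ρ m d κ σ : ℝ} (hρ : 0 ≤ ρ) (hP : 0 ≤ P)
    (hκ0 : 0 ≤ κ) (hκ1 : κ ≤ 1) (hσ : σ = 1 ∨ σ = -1) (hm0 : 0 ≤ m) (hm1 : m ≤ 1 / 2)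
    (hd0 : 0 ≤ d) (hdρ : d ≤ ρ * m) (hρm : ρ * m ≤ 1 / 2) (hJ1 : J ≤ 1) (hJ'0 : 0 ≤ J')
    (hJJ : |J' - J| ≤ 3 * m)
    (h : P' - (((1 + κ * (σ * m)) ^ 6)⁻¹ * (1 + σ * d) ^ 4 - 1) * J' ≤
      (1 + κ * (σ * m)) ^ 2 * P) :
    P' - P ≤ 2 * σ * (2 * J * d + κ * (P - 3 * J) * m) +
      (P + 3 * (6 + 4 * ρ) + 120000 * (1 + ρ ^ 2)) * m ^ 2 := by
  have hσ2 : σ ^ 2 = 1 := by rcases hσ with h | h <;> rw [h] <;> norm_num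
  have hσa : |σ| = 1 := by rcases hσ with h | h <;> rw [h] <;> norm_num
  have hκm : κ * m ≤ m := mul_le_of_le_one_left hm0 hκ1
  have hκm0 : 0 ≤ κ * m := by positivity
  have hκm2 : (κ * m) ^ 2 ≤ m ^ 2 := by gcongr
  have hη : |κ * (σ * m)| ≤ 1 / 2 := by
    rw [abs_mul, abs_mul, hσa, abs_of_nonneg hκ0, abs_of_nonneg hm0]
    linarith
  have hd : |σ * d| ≤ 1 / 2 := by
    rw [abs_mul, hσa, abs_of_nonneg hd0]
    linarith
  have hT := (abs_le.1 (abs_inv_pow_mul_pow_sub_le hη hd)).2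
  generalize ((1 + κ * (σ * m)) ^ 6)⁻¹ * (1 + σ * d) ^ 4 = T at h hT
  have hTb : T - 1 ≤ σ * (4 * d - 6 * κ * m) + 40000 * (1 + ρ ^ 2) * m ^ 2 := by
    have h2 : (κ * (σ * m)) ^ 2 ≤ m ^ 2 := by
      have : (κ * (σ * m)) ^ 2 = (κ * m) ^ 2 := by linear_combination (κ ^ 2 * m ^ 2) * hσ2
      linarith
    have h3 : (σ * d) ^ 2 ≤ ρ ^ 2 * m ^ 2 := by
      rw [mul_pow, hσ2, ← mul_pow, one_mul]
      gcongr
    linarith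
  have hJ'3 : J' ≤ 3 := by linarith [(abs_le.1 hJJ).2]
  have hTJ : (T - 1) * J' ≤ σ * (4 * d - 6 * κ * m) * J +
      3 * (6 + 4 * ρ) * m ^ 2 + 120000 * (1 + ρ ^ 2) * m ^ 2 := by
    have h1 := mul_le_mul_of_nonneg_right hTb hJ'0
    have h2 : 40000 * (1 + ρ ^ 2) * m ^ 2 * J' ≤ 40000 * (1 + ρ ^ 2) * m ^ 2 * 3 := by
      gcongr
    have h3 : σ * (4 * d - 6 * κ * m) * (J' - J) ≤ (6 + 4 * ρ) * m * (3 * m) := by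
      refine (le_abs_self _).trans ?_
      rw [abs_mul, abs_mul, hσa, one_mul]
      have : |4 * d - 6 * κ * m| ≤ (6 + 4 * ρ) * m := by
        have : 0 ≤ ρ * m := by positivity
        rw [abs_le]; constructor <;> linarith
      gcongr
    linarith
  have hv : (1 + κ * (σ * m)) ^ 2 * P ≤ P + 2 * σ * (κ * m) * P + m ^ 2 * P := by
    have : (1 + κ * (σ * m)) ^ 2 = 1 + 2 * σ * (κ * m) + (κ * m) ^ 2 := by
      linear_combination (κ ^ 2 * m ^ 2) * hσ2
    rw [this]
    have := mul_le_mul_of_nonneg_right hκm2 hP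
    linarith
  linarith

/-- `A` maximizes the interaction energy among patches of impulse `M` and area at most one. -/
structure IsMaxPatch (M : ℝ) (A : Set (ℝ × ℝ)) : Prop where
  patch : IsPatch A
  impulse : ∫ x in A, x.2 = M
  area : volume.real A ≤ 1
  maximal : ∀ S, IsPatch S → ∫ x in S, x.2 = M → volume.real S ≤ 1 → pairInt G S S ≤ pairInt G A A

lemma IsMaxPatch.comparison {M : ℝ} (hM : 0 < M) {A S : Set (ℝ × ℝ)} (hA : IsMaxPatch M A)
    (hS : IsPatch S) {M' : ℝ} (hSM : ∫ x in S, x.2 = M') (hM' : 0 < M') {v : ℝ} (hv : 0 < v)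
    (hSv : volume.real S ≤ v) :
    pairInt G S S - ((v ^ 6)⁻¹ * (M' / M) ^ 4 - 1) * pairInt shearKernel S S ≤
      v ^ 2 * pairInt G A A := by
  set b := M' / (v * M) with hb
  set a := v / b with ha
  have hb0 : 0 < b := by positivity
  have ha0 : 0 < a := by positivity
  have hab : a * b = v := div_mul_cancel₀ _ hb0.ne'
  have h1 := pairInt_stretch_preimage ha0 hb0 hS
  have h2 := hA.maximal _ (hS.stretch_preimage ha0 hb0)
    (by rw [impulse_stretch_preimage ha0 hb0 hS.meas, hSM, hab, hb]; field_simp)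
    (by
      rw [measureReal_def, volume_stretch_preimage ha0 hb0 hS.meas, ENNReal.toReal_mul,
        ENNReal.toReal_ofReal (by positivity), hab, ← measureReal_def, inv_mul_le_iff₀ hv]
      linarith)
  have e : (b / a) ^ 2 = (v ^ 6)⁻¹ * (M' / M) ^ 4 := by
    rw [ha, hb]; field_simp
  rw [e, hab] at h1
  have h3 := mul_le_mul_of_nonneg_left (h1.trans h2) (show 0 ≤ v ^ 2 by positivity)
  rwa [← mul_assoc, ← mul_pow, mul_inv_cancel₀ hv.ne', one_pow, one_mul] at h3

/-! ### First variation of the energy at a maximizing patch -/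

lemma IsPatch.exists_perturb {A B : Set (ℝ × ℝ)} (hA : IsPatch A) (hB : IsPatch B) {σ : ℝ}
    (hσ : σ = 1 ∧ Disjoint A B ∨ σ = -1 ∧ B ⊆ A) :
    ∃ S, IsPatch S ∧ ∫ x in S, x.2 = (∫ x in A, x.2) + σ * ∫ x in B, x.2 ∧
      volume.real S = volume.real A + σ * volume.real B ∧
      pairInt G S S = pairInt G A A + 2 * σ * pairInt G B A + pairInt G B B ∧
      pairInt shearKernel S S = pairInt shearKernel A A + 2 * σ * pairInt shearKernel B A +
        pairInt shearKernel B B := by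
  rcases hσ with ⟨rfl, hd⟩ | ⟨rfl, hBA⟩
  · have hU := hA.union hB
    refine ⟨A ∪ B, hU, ?_, ?_, ?_, ?_⟩
    · rw [setIntegral_union hd hB.meas hA.imp hB.imp, one_mul]
    · rw [measureReal_union hd hB.meas hA.fin hB.fin, one_mul]
    · rw [pairInt_union_self G_comm hA.meas hB.meas hd (hU.integrableOn_G hU), mul_one]
    · rw [pairInt_union_self shearKernel_comm hA.meas hB.meas hd (hU.integrableOn_shearKernel hU),
        mul_one]
  · have hS : IsPatch (A \ B) := hA.mono (hA.meas.diff hB.meas) sdiff_subset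
    have hd : Disjoint (A \ B) B := disjoint_sdiff_left
    have hu : A \ B ∪ B = A := sdiff_union_of_subset hBA
    refine ⟨A \ B, hS, ?_, ?_, ?_, ?_⟩
    · have := setIntegral_union hd hB.meas hS.imp hB.imp
      rw [hu] at this
      linarith
    · have := measureReal_union hd hB.meas hS.fin hB.fin
      rw [hu] at this
      linarith
    · have h1 := pairInt_union_self G_comm hS.meas hB.meas hd
        (by rw [hu]; exact hA.integrableOn_G hA)
      have h2 := pairInt_union_left hB.meas hB.meas hd (hS.integrableOn_G hB) (hB.integrableOn_G hB)
      rw [pairInt_comm G_comm, pairInt_comm G_comm (A \ B)] at h2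
      rw [hu] at h1 h2
      linarith
    · have h1 := pairInt_union_self shearKernel_comm hS.meas hB.meas hd
        (by rw [hu]; exact hA.integrableOn_shearKernel hA)
      have h2 := pairInt_union_left hB.meas hB.meas hd (hS.integrableOn_shearKernel hB)
        (hB.integrableOn_shearKernel hB)
      rw [pairInt_comm shearKernel_comm, pairInt_comm shearKernel_comm (A \ B)] at h2
      rw [hu] at h1 h2
      linarith

/-- The speed of a maximizing patch of impulse `M`. -/
def patchSpeed (M : ℝ) (A : Set (ℝ × ℝ)) : ℝ := 2 * pairInt shearKernel A A / M

open Classical in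
/-- The indicator of saturation of the area constraint. -/
def saturation (A : Set (ℝ × ℝ)) : ℝ := if volume.real A = 1 then 1 else 0

/-- The flux constant of a maximizing patch. -/
def patchFlux (A : Set (ℝ × ℝ)) : ℝ :=
  saturation A * (pairInt G A A - 3 * pairInt shearKernel A A)

lemma IsMaxPatch.self_energy_le {M : ℝ} (hM : 0 < M) {A B : Set (ℝ × ℝ)} (hA : IsMaxPatch M A)
    (hB : IsPatch B) {σ ρ : ℝ} (hσ : σ = 1 ∧ Disjoint A B ∨ σ = -1 ∧ B ⊆ A) (hρ : 0 ≤ ρ)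
    (hBρ : (∫ x in B, x.2) / M ≤ ρ * volume.real B) (hm : volume.real B ≤ 1 / 2)
    (hρm : ρ * volume.real B ≤ 1 / 2)
    (hm' : volume.real A ≠ 1 → volume.real A + volume.real B ≤ 1)
    (hΨ : ∀ x ∈ B, 0 ≤ σ * ((∫ y in A, G x y) - patchSpeed M A * x.2 - patchFlux A)) :
    pairInt G B B ≤
      (pairInt G A A + 3 * (6 + 4 * ρ) + 120000 * (1 + ρ ^ 2)) * volume.real B ^ 2 := by
  obtain ⟨S, hS, hSx, hSv, hSP, hSJ⟩ := hA.patch.exists_perturb hB hσ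
  have hσ' : σ = 1 ∨ σ = -1 := hσ.imp And.left And.left
  have hp0 : 0 ≤ ∫ x in B, x.2 :=
    setIntegral_nonneg hB.meas fun x hx => (hB.subset_H hx : 0 < x.2).le
  have hm0 : 0 ≤ volume.real B := measureReal_nonneg
  have ha0 : 0 ≤ volume.real A := measureReal_nonneg
  have ha1 := hA.area
  have hκ : saturation A = 1 ∧ volume.real A = 1 ∨
      saturation A = 0 ∧ volume.real A + volume.real B ≤ 1 := by
    unfold saturation
    split_ifs with h
    · exact .inl ⟨rfl, h⟩
    · exact .inr ⟨rfl, hm' h⟩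
  have hk0 : ∀ {S T}, IsPatch S → IsPatch T → 0 ≤ pairInt shearKernel S T := fun h1 h2 =>
    pairInt_nonneg (fun _ hx _ hy => shearKernel_nonneg hx hy) h1 h2
  have hJ1 := pairInt_shearKernel_le hA.patch hA.patch
  have hJ2 := pairInt_shearKernel_le hB hA.patch
  have hJ3 := pairInt_shearKernel_le hB hB
  have hJ20 := hk0 hB hA.patch
  have hJ30 := hk0 hB hB
  have hF : pairInt G B A = ∫ x in B, ∫ y in A, G x y := pairInt_G_eq hB hA.patch
  have hint : 0 ≤ σ * (pairInt G B A - patchSpeed M A * (∫ x in B, x.2) -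
      patchFlux A * volume.real B) := by
    have h := setIntegral_nonneg (μ := volume) hB.meas hΨ
    have hi1 := hB.integrableOn_pot hA.patch
    have hi2 := hB.imp.const_mul (patchSpeed M A)
    have hi3 : Integrable (fun x : ℝ × ℝ => (∫ y in A, G x y) - patchSpeed M A * x.2)
      (volume.restrict B) := hi1.sub hi2
    rw [integral_const_mul, integral_sub hi3 (integrableOn_const hB.fin),
      integral_sub hi1 hi2, integral_const_mul, setIntegral_const, ← hF, smul_eq_mul] at h
    linarith
  set P := pairInt G A A
  set J := pairInt shearKernel A A
  set p := ∫ x in B, x.2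
  set m := volume.real B
  have hd1 : p / M ≤ 1 / 2 := hBρ.trans hρm
  have hpM : p ≤ M * (1 / 2) := by rwa [div_le_iff₀' hM] at hd1
  have hv : volume.real S ≤ 1 + saturation A * (σ * m) := by
    rw [hSv]
    rcases hκ with ⟨h1, h2⟩ | ⟨h1, h2⟩ <;> rw [h1] <;> rcases hσ' with h | h <;> rw [h] <;>
      linarith
  have hv0 : 0 < 1 + saturation A * (σ * m) := by
    rcases hκ with ⟨h1, h2⟩ | ⟨h1, h2⟩ <;> rw [h1] <;> rcases hσ' with h | h <;> rw [h] <;>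
      linarith
  have hM' : 0 < M + σ * p := by
    rcases hσ' with h | h <;> rw [h] <;> linarith
  rw [hA.impulse] at hSx
  have hc := hA.comparison hM hS hSx hM' hv0 hv
  rw [show (M + σ * p) / M = 1 + σ * (p / M) by field_simp] at hc
  have hmm : m * m ≤ m := by nlinarith
  have hma : m * volume.real A ≤ m := by nlinarith
  have hgain := gain_le_of_comparison hρ
    (pairInt_nonneg (fun _ hx _ hy => G_nonneg hx hy) hA.patch hA.patch)
    (by rcases hκ with h | h <;> simp [h.1]) (by rcases hκ with h | h <;> simp [h.1]) hσ' hm0 hm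
    (by positivity) hBρ hρm (hJ1.trans (by nlinarith)) (hk0 hS hS)
    (by
      rw [hSJ, abs_le]
      rcases hσ' with h | h <;> rw [h] <;> constructor <;> linarith) hc
  rw [hSP] at hgain
  have e1 : 2 * J * (p / M) = patchSpeed M A * p := by unfold patchSpeed; ring
  have e2 : saturation A * (P - 3 * J) = patchFlux A := rfl
  rw [e1, e2] at hgain
  linarith

/-! ### Concentration of the self-interaction on small sets -/

lemma log_le_G {x y : ℝ × ℝ} {a b : ℝ} (ha : 0 < a) (hb : 0 < b) (hx : a ≤ x.2)
    (hy : a ≤ y.2) (hne : x.1 ≠ y.1) (h1 : |x.1 - y.1| ≤ b) (h2 : |x.2 - y.2| ≤ b) :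
    1 / (4 * π) * Real.log (2 * a ^ 2 / b ^ 2) ≤ G x y := by
  have h0 := sub_ne_zero.2 hne
  unfold G
  have hpos : 0 < (x.1 - y.1) ^ 2 + (x.2 - y.2) ^ 2 := by positivity
  have e1 : (x.1 - y.1) ^ 2 ≤ b ^ 2 := sq_le_sq' (by linarith [abs_le.1 h1]) (abs_le.1 h1).2
  have e2 : (x.2 - y.2) ^ 2 ≤ b ^ 2 := sq_le_sq' (by linarith [abs_le.1 h2]) (abs_le.1 h2).2
  gcongr
  have : 2 * a ^ 2 / b ^ 2 ≤ 4 * x.2 * y.2 / ((x.1 - y.1) ^ 2 + (x.2 - y.2) ^ 2) := by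
    rw [show 2 * a ^ 2 / b ^ 2 = 4 * a * a / (2 * b ^ 2) by field_simp; norm_num]
    have hx0 : 0 < x.2 := by linarith
    have hy0 : 0 < y.2 := by linarith
    gcongr
    linarith
  linarith

lemma exists_small_patch {N : Set (ℝ × ℝ)} (hN : MeasurableSet N) (hNH : N ⊆ H)
    (h0 : volume N ≠ 0) :
    ∃ R : ℝ, 0 < R ∧ ∀ K m₀ : ℝ, 0 < m₀ → ∃ B ⊆ N, IsPatch B ∧ volume.real B ≤ m₀ ∧
      ∫ x in B, x.2 ≤ R * volume.real B ∧ K * volume.real B ^ 2 < pairInt G B B := by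
  obtain ⟨x₀, hx₀, hx₀'⟩ := exists_mem_forall_mem_nhdsWithin_pos_measure h0
  have hh : 0 < x₀.2 := hNH hx₀
  refine ⟨x₀.2 + 1, by linarith, fun K m₀ hm₀ => ?_⟩
  -- the radius must beat the logarithmic threshold
  set E := Real.exp (-(2 * π * (|K| + 1))) with hE
  have hE0 : 0 < E := Real.exp_pos _
  set r := min (min 1 (x₀.2 / 2)) (min (√m₀ / 2) (x₀.2 / 4 * E)) with hr
  have hr0 : 0 < r := by positivity
  have hr1 : r ≤ 1 := (min_le_left _ _).trans (min_le_left _ _)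
  have hr2 : r ≤ x₀.2 / 2 := (min_le_left _ _).trans (min_le_right _ _)
  have hr3 : r ≤ √m₀ / 2 := (min_le_right _ _).trans (min_le_left _ _)
  have hr4 : r ≤ x₀.2 / 4 * E := (min_le_right _ _).trans (min_le_right _ _)
  set B := N ∩ Metric.ball x₀ r with hB
  have hBm : MeasurableSet B := hN.inter measurableSet_ball
  have hBx : ∀ x ∈ B, |x.1 - x₀.1| < r ∧ |x.2 - x₀.2| < r := fun x hx => by
    have := hx.2
    rw [Metric.mem_ball, Prod.dist_eq, max_lt_iff, Real.dist_eq, Real.dist_eq] at this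
    exact this
  have hball : volume (Metric.ball x₀ r) = ENNReal.ofReal ((2 * r) ^ 2) := by
    rw [show x₀ = (x₀.1, x₀.2) from rfl, ← ball_prod_same, Measure.volume_eq_prod,
      Measure.prod_prod, Real.volume_ball, Real.volume_ball, ← ENNReal.ofReal_mul (by positivity),
      sq]
  have hBv : volume B ≤ ENNReal.ofReal ((2 * r) ^ 2) :=
    (measure_mono inter_subset_right).trans hball.le
  have hBfin : volume B ≠ ⊤ := (hBv.trans_lt ENNReal.ofReal_lt_top).ne
  have hB0 : 0 < volume.real B := ENNReal.toReal_pos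
    (hx₀' _ (inter_mem self_mem_nhdsWithin
      (mem_nhdsWithin_of_mem_nhds (Metric.ball_mem_nhds _ hr0)))).ne' hBfin
  have hBi : IntegrableOn (fun x : ℝ × ℝ => x.2) B := by
    refine (integrableOn_const hBfin (C := x₀.2 + 1)).mono' (by fun_prop) ?_
    filter_upwards [ae_restrict_mem hBm] with x hx
    have h1 := abs_lt.1 (hBx x hx).2
    have h2 : 0 < x.2 := hNH hx.1
    rw [Real.norm_of_nonneg h2.le]
    linarith
  have hBp : IsPatch B := ⟨inter_subset_left.trans hNH, hBm, hBfin, hBi⟩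
  refine ⟨B, inter_subset_left, hBp, ?_, ?_, ?_⟩
  · refine (ENNReal.toReal_le_of_le_ofReal (by positivity) hBv).trans ?_
    calc (2 * r) ^ 2 ≤ (√m₀) ^ 2 := by gcongr; linarith
      _ = m₀ := Real.sq_sqrt hm₀.le
  · have h := setIntegral_mono_on hBi (integrableOn_const hBfin (C := x₀.2 + 1)) hBm
      fun x hx => by linarith [abs_lt.1 (hBx x hx).2]
    rwa [setIntegral_const, smul_eq_mul, mul_comm] at h
  · have hne : ∀ᵐ p : (ℝ × ℝ) × (ℝ × ℝ), p.1.1 ≠ p.2.1 := by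
      rw [Measure.volume_eq_prod]
      refine (Measure.ae_prod_iff_ae_ae ?_).2 (ae_of_all _ fun x => ae_fst_ne x.1)
      exact (measurableSet_eq_fun (by fun_prop) (by fun_prop)).compl
    have hfin : volume (B ×ˢ B) ≠ ⊤ := by
      rw [Measure.volume_eq_prod, Measure.prod_prod]
      exact ENNReal.mul_ne_top hBfin hBfin
    have hlow : |K| + 1 ≤ 1 / (4 * π) * Real.log (2 * (x₀.2 / 2) ^ 2 / (2 * r) ^ 2) := by
      have h1 : E⁻¹ ^ 2 ≤ 2 * (x₀.2 / 2) ^ 2 / (2 * r) ^ 2 := by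
        rw [le_div_iff₀ (by positivity)]
        calc E⁻¹ ^ 2 * (2 * r) ^ 2 ≤ E⁻¹ ^ 2 * (2 * (x₀.2 / 4 * E)) ^ 2 := by gcongr
          _ = (x₀.2 / 2) ^ 2 := by field_simp; norm_num
          _ ≤ _ := by nlinarith [sq_nonneg (x₀.2 / 2)]
      have h2 := Real.log_le_log (by positivity) h1
      rw [Real.log_pow, Real.log_inv, hE, Real.log_exp] at h2
      push_cast at h2
      rw [one_div, le_inv_mul_iff₀ (by positivity)]
      linarith
    have h := setIntegral_mono_ae_restrict (integrableOn_const hfin (C := |K| + 1))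
      (hBp.integrableOn_G hBp) (by
        filter_upwards [ae_restrict_of_ae hne, ae_restrict_mem (hBm.prod hBm)] with p hp hpB
        have a1 := hBx _ hpB.1
        have a2 := hBx _ hpB.2
        simp only [abs_lt] at a1 a2
        refine hlow.trans (log_le_G (by positivity) (by positivity) ?_ ?_ hp ?_ ?_)
        · linarith
        · linarith
        · rw [abs_le]; constructor <;> linarith
        · rw [abs_le]; constructor <;> linarith)
    rw [setIntegral_const, smul_eq_mul, Measure.volume_eq_prod, measureReal_prod_prod] at h
    calc K * volume.real B ^ 2 < (|K| + 1) * volume.real B ^ 2 := by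
          gcongr; linarith [le_abs_self K]
      _ = volume.real B * volume.real B * (|K| + 1) := by ring
      _ ≤ pairInt G B B := by rw [pairInt, Measure.volume_eq_prod]; exact h

/-! ### Maximizing patches are superlevel sets -/

lemma IsMaxPatch.measure_ne_zero {M : ℝ} (hM : 0 < M) {A : Set (ℝ × ℝ)} (hA : IsMaxPatch M A) :
    volume A ≠ 0 := fun h => by
  have := hA.impulse
  rw [setIntegral_measure_zero _ h] at this
  exact hM.ne this

lemma IsMaxPatch.patchSpeed_pos {M : ℝ} (hM : 0 < M) {A : Set (ℝ × ℝ)} (hA : IsMaxPatch M A) :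
    0 < patchSpeed M A :=
  div_pos (mul_pos two_pos (pairInt_shearKernel_pos hA.patch (hA.measure_ne_zero hM))) hM

/-- No set of positive measure can be favourably exchanged. -/
lemma IsMaxPatch.null_of_favourable {M : ℝ} (hM : 0 < M) {A N : Set (ℝ × ℝ)}
    (hA : IsMaxPatch M A) (hN : MeasurableSet N) (hNH : N ⊆ H) {σ : ℝ}
    (hσ : σ = 1 ∧ Disjoint A N ∨ σ = -1 ∧ N ⊆ A)
    (hΨ : ∀ x ∈ N, 0 ≤ σ * ((∫ y in A, G x y) - patchSpeed M A * x.2 - patchFlux A)) :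
    volume N = 0 := by
  by_contra h0
  obtain ⟨R, hR, hB⟩ := exists_small_patch hN hNH h0
  obtain ⟨δ, hδ, hδA⟩ : ∃ δ > 0, volume.real A ≠ 1 → volume.real A + δ ≤ 1 := by
    by_cases h : volume.real A = 1
    · exact ⟨1, one_pos, fun h' => (h' h).elim⟩
    · exact ⟨1 - volume.real A, sub_pos.2 (lt_of_le_of_ne hA.area h), fun _ => by linarith⟩
  have hρ : 0 < R / M := div_pos hR hM
  obtain ⟨B, hBN, hBp, hBm, hBx, hlt⟩ := hB
    (pairInt G A A + 3 * (6 + 4 * (R / M)) + 120000 * (1 + (R / M) ^ 2))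
    (min (1 / 2) (min δ (1 / 2 / (R / M)))) (by positivity)
  have hb1 := hBm.trans (min_le_left _ _)
  have hb2 := hBm.trans ((min_le_right _ _).trans (min_le_left _ _))
  have hb3 := hBm.trans ((min_le_right _ _).trans (min_le_right _ _))
  refine hlt.not_ge (hA.self_energy_le hM hBp
    (hσ.imp (And.imp_right (·.mono_right hBN)) (And.imp_right hBN.trans)) hρ.le ?_ hb1 ?_
    (fun h => ?_) fun x hx => hΨ x (hBN hx))
  · rw [div_mul_eq_mul_div]
    gcongr
  · rwa [le_div_iff₀' hρ] at hb3
  · linarith [hδA h]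

lemma IsMaxPatch.ae_mem_iff {M : ℝ} (hM : 0 < M) {A : Set (ℝ × ℝ)} (hA : IsMaxPatch M A) :
    ∀ᵐ x ∂volume.restrict H, (x ∈ A ↔ patchSpeed M A * x.2 + patchFlux A < ∫ y in A, G x y) := by
  have hf : Measurable (fun x => ∫ y in A, G x y) :=
    (measurable_G.stronglyMeasurable.integral_prod_right (ν := volume.restrict A)).measurable
  have hm : MeasurableSet {x : ℝ × ℝ | patchSpeed M A * x.2 + patchFlux A < ∫ y in A, G x y} :=
    measurableSet_lt (by fun_prop) hf
  have hm' : MeasurableSet {x : ℝ × ℝ | patchSpeed M A * x.2 + patchFlux A ≤ ∫ y in A, G x y} :=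
    measurableSet_le (by fun_prop) hf
  have h1 := hA.null_of_favourable hM (N := A \ {x | _ < _}) (σ := -1) (hA.patch.meas.diff hm)
    (sdiff_subset.trans hA.patch.subset_H) (.inr ⟨rfl, sdiff_subset⟩) fun x hx => by
      have := hx.2
      rw [mem_ofPred_eq, not_lt] at this
      linarith
  have h2 := hA.null_of_favourable hM (N := (H ∩ {x | _ ≤ _}) \ A) (σ := 1)
    ((measurableSet_H.inter hm').diff hA.patch.meas) (sdiff_subset.trans inter_subset_left)
    (.inl ⟨rfl, disjoint_sdiff_right⟩) fun x hx => by
      have := hx.1.2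
      rw [mem_ofPred_eq] at this
      linarith
  filter_upwards [ae_restrict_mem measurableSet_H,
    ae_restrict_of_ae (measure_eq_zero_iff_ae_notMem.1 h1),
    ae_restrict_of_ae (measure_eq_zero_iff_ae_notMem.1 h2)] with x hx hx1 hx2
  refine ⟨fun h => by_contra fun h' => hx1 ⟨h, h'⟩, fun h => by_contra fun h' => hx2 ⟨⟨hx, ?_⟩, h'⟩⟩
  exact le_of_lt h

lemma IsMaxPatch.patchFlux_nonneg {M : ℝ} (hM : 0 < M) {A : Set (ℝ × ℝ)} (hA : IsMaxPatch M A) :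
    0 ≤ patchFlux A := by
  by_contra! hγ
  have hW := hA.patchSpeed_pos hM
  set s : ℝ := -patchFlux A / patchSpeed M A
  have hs : 0 < s := div_pos (neg_pos.2 hγ) hW
  have hae : ∀ᵐ x, x ∈ (univ : Set ℝ) ×ˢ Ioo 0 s → x ∈ A := by
    filter_upwards [(ae_restrict_iff' measurableSet_H).1 (hA.ae_mem_iff hM)] with x hx hxs
    have hxH : x ∈ H := hxs.2.1
    refine (hx hxH).2 (lt_of_lt_of_le ?_ (setIntegral_nonneg hA.patch.meas fun y hy =>
      G_nonneg hxH (hA.patch.subset_H hy)))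
    have := (lt_div_iff₀' hW).1 hxs.2.2
    linarith
  have hle : volume ((univ : Set ℝ) ×ˢ Ioo 0 s) ≤ volume A := measure_mono_ae hae
  rw [Measure.volume_eq_prod, Measure.prod_prod, Real.volume_univ, Real.volume_Ioo,
    ENNReal.top_mul (by simpa using hs), ← Measure.volume_eq_prod] at hle
  exact hA.patch.fin (top_le_iff.1 hle)

/-! ### From patches to vorticities -/

lemma Gpot_eq_of_ae_eq {A : Set (ℝ × ℝ)} (hA : MeasurableSet A) (hAH : A ⊆ H) {ω : ℝ × ℝ → ℝ}
    (hω : ∀ᵐ x ∂volume.restrict H, ω x = A.indicator (fun _ => (1 : ℝ)) x) (x : ℝ × ℝ) :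
    Gpot ω x = ∫ y in A, G x y := by
  have e : ∀ᵐ y ∂volume.restrict H, G x y * ω y = A.indicator (G x) y := by
    filter_upwards [hω] with y hy
    rw [hy]
    by_cases h : y ∈ A <;> simp [h]
  rw [Gpot, integral_congr_ae e, setIntegral_indicator hA, inter_eq_right.2 hAH]

lemma energy_eq_of_ae_eq {A : Set (ℝ × ℝ)} (hA : IsPatch A) {ω : ℝ × ℝ → ℝ}
    (hω : ∀ᵐ x ∂volume.restrict H, ω x = A.indicator (fun _ => (1 : ℝ)) x) :
    energy ω = 1 / 2 * pairInt G A A := by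
  have e : ∀ᵐ x ∂volume.restrict H, ∫ y in H, G x y * ω x * ω y =
      A.indicator (fun x => ∫ y in A, G x y) x := by
    filter_upwards [hω] with x hx
    have h1 : ∫ y in H, G x y * ω x * ω y = ω x * Gpot ω x := by
      rw [Gpot, ← integral_const_mul]
      congr 1
      ext y
      ring
    rw [h1, Gpot_eq_of_ae_eq hA.meas hA.subset_H hω, hx]
    by_cases h : x ∈ A <;> simp [h]
  rw [energy, integral_congr_ae e, setIntegral_indicator hA.meas, inter_eq_right.2 hA.subset_H,
    pairInt_G_eq hA hA]

lemma memS.exists_isMaxPatch {M : ℝ} (hM : 0 < M) {ω : ℝ × ℝ → ℝ} (hω : memS M ω) :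
    ∃ A, IsMaxPatch M A ∧
      ∀ᵐ x ∂volume.restrict H, ω x = A.indicator (fun _ => (1 : ℝ)) x := by
  obtain ⟨⟨-, A, hAH, hAm, hωA, hAM, hA1⟩, hmax⟩ := hω
  have hA : IsPatch A := ⟨hAH, hAm, (hA1.trans_lt ENNReal.one_lt_top).ne,
    not_imp_comm.1 integral_undef (hAM.trans_ne hM.ne')⟩
  refine ⟨A, ⟨hA, hAM, ENNReal.toReal_le_of_le_ofReal zero_le_one (by simpa using hA1),
    fun S hS hSM hS1 => ?_⟩, hωA⟩
  have hSae : ∀ᵐ x ∂volume.restrict H,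
      S.indicator (fun _ => (1 : ℝ)) x = S.indicator (fun _ => (1 : ℝ)) x :=
    ae_of_all _ fun _ => rfl
  have h := hmax (S.indicator fun _ => 1)
    ⟨((integrable_indicator_iff hS.meas).2 (integrableOn_const hS.fin)).restrict, S, hS.subset_H,
      hS.meas, hSae, hSM, (ENNReal.toReal_le_toReal hS.fin ENNReal.one_ne_top).1
        (by simpa [Measure.real] using hS1)⟩
  rw [energy_eq_of_ae_eq hS hSae, energy_eq_of_ae_eq hA hωA] at h
  linarith

lemma eq_superlevel_indicator_iff {A : Set (ℝ × ℝ)} (hA : MeasurableSet A) (hAH : A ⊆ H)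
    {ω : ℝ × ℝ → ℝ} (hω : ∀ᵐ x ∂volume.restrict H, ω x = A.indicator (fun _ => (1 : ℝ)) x)
    (W γ : ℝ) :
    (∀ᵐ x ∂volume.restrict H,
      ω x = Set.indicator {y ∈ H | 0 < Gpot ω y - W * y.2 - γ} (fun _ => (1 : ℝ)) x) ↔
    ∀ᵐ x ∂volume.restrict H, (x ∈ A ↔ W * x.2 + γ < ∫ y in A, G x y) := by
  refine eventually_congr ?_
  filter_upwards [hω, ae_restrict_mem measurableSet_H] with x hx hxH
  have e : x ∈ {y ∈ H | 0 < Gpot ω y - W * y.2 - γ} ↔ W * x.2 + γ < ∫ y in A, G x y := by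
    rw [mem_ofPred_eq, Gpot_eq_of_ae_eq hA hAH hω, sub_sub, sub_pos]
    exact and_iff_right hxH
  rw [hx, ← e]
  by_cases h1 : x ∈ A <;> by_cases h2 : x ∈ {y ∈ H | 0 < Gpot ω y - W * y.2 - γ} <;>
    simp only [h1, h2, indicator_of_mem, indicator_of_notMem, not_false_eq_true] <;> norm_num

/-- each maximizer `ω ∈ S_M` is of the form
`1_{{𝒢[ω] − W x₂ − γ > 0}}` for constants `W > 0`, `γ ≥ 0` uniquely determined by `ω`. -/
theorem maximizer_form_unique_constants (M : ℝ) (hM : 0 < M)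
    (ω : ℝ × ℝ → ℝ) (hω : memS M ω) :
    ∃ W γ : ℝ, 0 < W ∧ 0 ≤ γ ∧
      (∀ᵐ x ∂volume.restrict H,
        ω x = Set.indicator {y ∈ H | 0 < Gpot ω y - W * y.2 - γ} (fun _ => (1 : ℝ)) x) ∧
      ∀ W' γ' : ℝ,
        (∀ᵐ x ∂volume.restrict H,
          ω x = Set.indicator {y ∈ H | 0 < Gpot ω y - W' * y.2 - γ'} (fun _ => (1 : ℝ)) x) →
        W' = W ∧ γ' = γ := by
  obtain ⟨A, hA, hωA⟩ := hω.exists_isMaxPatch hM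
  have hiff := eq_superlevel_indicator_iff hA.patch.meas hA.patch.subset_H hωA
  have hae := hA.ae_mem_iff hM
  have hW := hA.patchSpeed_pos hM
  have hγ := hA.patchFlux_nonneg hM
  exact ⟨_, _, hW, hγ, (hiff _ _).2 hae, fun W' γ' h =>
    superlevel_constants_unique hA.patch.meas hA.patch.subset_H hA.patch.fin
      (hA.measure_ne_zero hM) hW hγ hae ((hiff W' γ').1 h)⟩
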